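/- Let G be a finitely generated group such that there exists c > 0 with a_n(G) ≥ c·n for all n ≥ 1, and assume hypothesis (★) holds with α ≥ 2. Fix a real x > 0. Then the expectation of the number of orbits satisfies the asymptotic equivalence E[K_{G,n}] ∼ (1/(α−1)) · α^{−(m−1)/α} · (x·𝒦)^{1/α} · n^{(α−1)/α} · (ln n)^{(m−1)/α} as n → ∞. -/

import Mathlib

open scoped BigOperators

/-- `a_n(G)`: the number of subgroups of `G` of index exactly `n`. -/
noncomputable def aCount (G : Type*) [Group G] (n : ℕ) : ℕ :=
  Nat.card {H : Subgroup G // H.index = n}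

/-- `c(φ)`: the number of orbits of the action of `G` on `Fin n` induced by
`φ : G →* Equiv.Perm (Fin n)` (equivalently, the orbits of the range of `φ`). -/
noncomputable def numOrbits {G : Type*} [Group G] {n : ℕ} (φ : G →* Equiv.Perm (Fin n)) : ℕ :=
  Nat.card (Quotient (MulAction.orbitRel φ.range (Fin n)))

/-- The expectation `E[f(K_{G,n})]` for the `x`-biased measure on `Hom(G, S_n)`. -/
noncomputable def expVal (G : Type*) [Group G] (n : ℕ) (x : ℝ) (f : ℝ → ℝ) : ℝ :=
  (∑ᶠ φ : G →* Equiv.Perm (Fin n), f (numOrbits φ) * x ^ numOrbits φ) /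
    (∑ᶠ φ : G →* Equiv.Perm (Fin n), x ^ numOrbits φ)

section Combinatorics

variable {G : Type*} [Group G]

/-- The number of orbits of the action on `X` defined by a homomorphism to `Perm X`. -/
noncomputable def orbitCount {X : Type*} (φ : G →* Equiv.Perm X) : ℕ :=
  Nat.card (Quotient (MulAction.orbitRel φ.range X))

/-- The sum of `x ^ c(φ)` over all actions `φ` of `G` on `X`. -/
noncomputable def actionWeight (G : Type*) [Group G] (X : Type*) (x : ℝ) : ℝ :=
  ∑ᶠ φ : G →* Equiv.Perm X, x ^ orbitCount φ

lemma orbitRel_range_iff {X : Type*} (φ : G →* Equiv.Perm X) (a b : X) :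
    (MulAction.orbitRel φ.range X) a b ↔ ∃ g, φ g b = a := by
  rw [MulAction.orbitRel_apply, MulAction.mem_orbit_iff]
  constructor
  · rintro ⟨⟨_, g, rfl⟩, h⟩
    exact ⟨g, h⟩
  · rintro ⟨g, h⟩
    exact ⟨⟨φ g, g, rfl⟩, h⟩

instance finite_monoidHom_of_fg [Group.FG G] (H : Type*) [Group H] [Finite H] :
    Finite (G →* H) := by
  obtain ⟨S, hS⟩ := Group.fg_def.mp (inferInstance : Group.FG G)
  refine Finite.of_injective (fun (f : G →* H) (s : S) => f s) fun f g h => ?_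
  refine MonoidHom.eq_of_eqOn_dense hS fun s hs => ?_
  exact congrFun h ⟨s, hs⟩

lemma orbitCount_permCongr {X Y : Type*} (e : X ≃ Y) (φ : G →* Equiv.Perm X) :
    orbitCount ((e.permCongrHom : Equiv.Perm X →* Equiv.Perm Y).comp φ) = orbitCount φ := by
  refine (Nat.card_congr (Quotient.congr e fun a b => ?_)).symm
  rw [orbitRel_range_iff, orbitRel_range_iff]
  simp [Equiv.permCongrHom]

lemma actionWeight_congr {X Y : Type*} (e : X ≃ Y) (x : ℝ) :
    actionWeight G X x = actionWeight G Y x := by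
  refine finsum_eq_of_bijective
    (fun φ => (e.permCongrHom : Equiv.Perm X →* Equiv.Perm Y).comp φ) ⟨?_, ?_⟩ fun φ => ?_
  · intro φ ψ h
    ext1 g
    exact e.permCongrHom.injective (DFunLike.congr_fun h g)
  · intro ψ
    refine ⟨(e.permCongrHom.symm : Equiv.Perm Y →* Equiv.Perm X).comp ψ, ?_⟩
    ext1 g
    exact e.permCongrHom.apply_symm_apply (ψ g)
  · rw [orbitCount_permCongr]

/-- `φ` extends the translation action of `G` on the image of `G ⧸ K` under `ι`. -/
def Extends {X : Type*} {K : Subgroup G} (ι : G ⧸ K ↪ X) (φ : G →* Equiv.Perm X) : Prop :=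
  ∀ (g : G) (q : G ⧸ K), φ g (ι q) = ι (g • q)

lemma Extends.notMem_range {X : Type*} {K : Subgroup G} {ι : G ⧸ K ↪ X} {φ : G →* Equiv.Perm X}
    (h : Extends ι φ) (g : G) (a : X) : φ g a ∉ Set.range ι ↔ a ∉ Set.range ι := by
  rw [not_iff_not]
  constructor
  · rintro ⟨q, hq⟩
    refine ⟨g⁻¹ • q, ?_⟩
    rw [← h, hq, ← Equiv.Perm.mul_apply, ← map_mul]
    simp
  · rintro ⟨q, rfl⟩
    exact ⟨g • q, (h g q).symm⟩

/-- The action on the complement of the orbit `G ⧸ K`. -/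
def Extends.restrict {X : Type*} {K : Subgroup G} {ι : G ⧸ K ↪ X} {φ : G →* Equiv.Perm X}
    (h : Extends ι φ) : G →* Equiv.Perm {a // a ∉ Set.range ι} where
  toFun g := (φ g).subtypePerm (h.notMem_range g)
  map_one' := by ext; simp
  map_mul' a b := by ext c; exact congrFun (congrArg DFunLike.coe (map_mul φ a b)) c.1

lemma Extends.orbitCount_eq {X : Type*} [Finite X] {K : Subgroup G} {ι : G ⧸ K ↪ X}
    {φ : G →* Equiv.Perm X} (h : Extends ι φ) :
    orbitCount φ = orbitCount h.restrict + 1 := by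
  unfold orbitCount
  rw [← Finite.card_option]
  let f : Option (Quotient (MulAction.orbitRel h.restrict.range {a // a ∉ Set.range ι})) →
      Quotient (MulAction.orbitRel φ.range X) := fun o => o.elim
        (Quotient.mk _ (ι (1 : G))) (Quotient.map' Subtype.val fun a b hab => by
          obtain ⟨g, hg⟩ := (orbitRel_range_iff _ _ _).mp hab
          exact (orbitRel_range_iff _ _ _).mpr ⟨g, congrArg Subtype.val hg⟩)
  refine (Nat.card_congr (Equiv.ofBijective f ⟨?_, ?_⟩)).symm
  · have key : ∀ b : {a // a ∉ Set.range ι},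
        (Quotient.mk (MulAction.orbitRel φ.range X) (ι (1 : G))) ≠ Quotient.mk _ b.1 := by
      intro b hb
      obtain ⟨g, hg⟩ := (orbitRel_range_iff _ _ _).mp (Quotient.exact hb)
      exact ((h.notMem_range g b.1).mpr b.2) ⟨_, hg.symm⟩
    rintro (_ | a) (_ | b) hab
    · rfl
    · induction b using Quotient.inductionOn with | _ b => exact absurd hab (key b)
    · induction a using Quotient.inductionOn with | _ a => exact absurd hab.symm (key a)
    · induction a using Quotient.inductionOn with | _ a =>
      induction b using Quotient.inductionOn with | _ b =>
      obtain ⟨g, hg⟩ := (orbitRel_range_iff _ _ _).mp (Quotient.exact hab)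
      refine congrArg some (Quotient.sound ((orbitRel_range_iff _ _ _).mpr ⟨g, Subtype.ext hg⟩))
  · intro q
    induction q using Quotient.inductionOn with | _ a =>
    by_cases ha : a ∈ Set.range ι
    · obtain ⟨q, rfl⟩ := ha
      induction q using Quotient.inductionOn with | _ g =>
      refine ⟨none, Quotient.sound ((orbitRel_range_iff _ _ _).mpr ⟨g⁻¹, ?_⟩)⟩
      refine (h g⁻¹ (g : G ⧸ K)).trans ?_
      rw [MulAction.Quotient.smul_coe, smul_eq_mul, inv_mul_cancel]
    · exact ⟨some (Quotient.mk _ ⟨a, ha⟩), rfl⟩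

lemma Extends.restrict_bijective {X : Type*} {K : Subgroup G} (ι : G ⧸ K ↪ X) :
    Function.Bijective (fun φ : {φ : G →* Equiv.Perm X // Extends ι φ} => φ.2.restrict) := by
  classical
  constructor
  · rintro ⟨φ, hφ⟩ ⟨ψ, hψ⟩ h
    refine Subtype.ext (MonoidHom.ext fun g => Equiv.ext fun a => ?_)
    by_cases ha : a ∈ Set.range ι
    · obtain ⟨q, rfl⟩ := ha
      exact (hφ g q).trans (hψ g q).symm
    · have := congrArg (fun f => (f g ⟨a, ha⟩).1) h
      exact this
  · intro ψ
    let e : (G ⧸ K) ⊕ {a // a ∉ Set.range ι} ≃ X :=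
      ((Equiv.ofInjective ι ι.injective).sumCongr (Equiv.refl _)).trans
        (Equiv.sumCompl (· ∈ Set.range ι))
    let φ : G →* Equiv.Perm X := (e.permCongrHom : _ →* Equiv.Perm X).comp
      ((Equiv.Perm.sumCongrHom _ _).comp ((MulAction.toPermHom G (G ⧸ K)).prod ψ))
    have hl : ∀ q, e (Sum.inl q) = ι q := fun q => rfl
    have hr : ∀ q, e (Sum.inr q) = q.1 := fun q => rfl
    have hφ : Extends ι φ := by
      intro g q
      have : φ g (e (Sum.inl q)) = e (Sum.inl (g • q)) := by
        simp [φ, Equiv.permCongrHom]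
      exact this
    refine ⟨⟨φ, hφ⟩, MonoidHom.ext fun g => Equiv.ext fun a => Subtype.ext ?_⟩
    have : φ g (e (Sum.inr a)) = e (Sum.inr (ψ g a)) := by
      simp [φ, Equiv.permCongrHom]
    exact this

lemma sum_extends {X : Type*} [Finite X] {K : Subgroup G} (ι : G ⧸ K ↪ X) (x : ℝ) :
    ∑ᶠ φ : {φ : G →* Equiv.Perm X // Extends ι φ}, x ^ orbitCount φ.1 =
      x * actionWeight G {a // a ∉ Set.range ι} x := by
  rw [actionWeight, mul_finsum]
  refine finsum_eq_of_bijective _ (Extends.restrict_bijective ι) fun φ => ?_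
  rw [φ.2.orbitCount_eq, pow_succ']

lemma actionWeight_compl {n : ℕ} {K : Subgroup G} (ι : G ⧸ K ↪ Fin n) (x : ℝ) :
    actionWeight G {a // a ∉ Set.range ι} x = actionWeight G (Fin (n - K.index)) x := by
  classical
  have := Finite.of_injective ι ι.injective
  have := Fintype.ofFinite (G ⧸ K)
  refine actionWeight_congr (Finite.equivFinOfCardEq ?_) x
  have h := Nat.card_congr (Equiv.Set.sumCompl (Set.range ι))
  rw [Nat.card_sum, Nat.card_fin, Nat.card_range_of_injective ι.injective,
    ← Subgroup.index_eq_card] at h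
  change Nat.card ↑(Set.range ι)ᶜ = _
  omega

/-- Pointed actions on `X` correspond to actions together with an embedded orbit. -/
lemma pointed_bijective (n : ℕ) : Function.Bijective
    (fun s : Σ (j : Fin n) (K : {K : Subgroup G // K.index = j + 1}) (ι : G ⧸ K.1 ↪ Fin n),
      {φ : G →* Equiv.Perm (Fin n) // Extends ι φ} =>
      ((s.2.2.2.1, s.2.2.1 (1 : G)) : (G →* Equiv.Perm (Fin n)) × Fin n)) := by
  have hval : ∀ {K : Subgroup G} (ι : G ⧸ K ↪ Fin n) (φ : G →* Equiv.Perm (Fin n)),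
      Extends ι φ → ∀ g : G, ι g = φ g (ι (1 : G)) := by
    intro K ι φ h g
    rw [h, MulAction.Quotient.smul_coe, smul_eq_mul, mul_one]
  have hstab : ∀ {K : Subgroup G} (ι : G ⧸ K ↪ Fin n) (φ : G →* Equiv.Perm (Fin n)),
      Extends ι φ → ∀ g : G, g ∈ K ↔ φ g (ι (1 : G)) = ι (1 : G) := by
    intro K ι φ h g
    rw [← hval ι φ h, ι.injective.eq_iff, eq_comm, QuotientGroup.eq]
    simp
  constructor
  · rintro ⟨j, ⟨K, hK⟩, ι, φ, hφ⟩ ⟨j', ⟨K', hK'⟩, ι', φ', hφ'⟩ h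
    obtain ⟨rfl, h2⟩ := Prod.mk.inj h
    simp only at h2
    obtain rfl : K = K' := by
      ext g
      rw [hstab ι φ hφ, hstab ι' φ hφ', h2]
    obtain rfl : j = j' := Fin.ext (by have := hK.symm.trans hK'; omega)
    obtain rfl : ι = ι' := by
      ext1 q
      induction q using Quotient.inductionOn with | _ g =>
      exact (hval ι φ hφ g).trans ((congrArg _ h2).trans (hval ι' φ hφ' g).symm)
    rfl
  · rintro ⟨φ, p⟩
    let K : Subgroup G := (MulAction.stabilizer (Equiv.Perm (Fin n)) p).comap φ
    let ι : G ⧸ K ↪ Fin n :=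
      { toFun := Quotient.lift (fun g => φ g p) (by
          intro a b hab
          have : φ (a⁻¹ * b) p = p := QuotientGroup.leftRel_apply.mp hab
          rw [map_mul, map_inv, Equiv.Perm.mul_apply, Equiv.Perm.inv_eq_iff_eq] at this
          exact this.symm)
        inj' := by
          intro a b
          induction a using Quotient.inductionOn with | _ a =>
          induction b using Quotient.inductionOn with | _ b =>
          intro hab
          refine Quotient.sound (QuotientGroup.leftRel_apply.mpr ?_)
          change φ (a⁻¹ * b) p = p
          rw [map_mul, map_inv, Equiv.Perm.mul_apply, Equiv.Perm.inv_eq_iff_eq]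
          exact hab.symm }
    have hφ : Extends ι φ := by
      intro g q
      induction q using Quotient.inductionOn with | _ a =>
      change φ g (φ a p) = φ (g * a) p
      rw [map_mul, Equiv.Perm.mul_apply]
    have := Finite.of_injective ι ι.injective
    have hpos : 0 < K.index := by
      rw [Subgroup.index_eq_card]; exact Nat.card_pos
    have hle : K.index ≤ n := by
      rw [Subgroup.index_eq_card]
      simpa using Nat.card_le_card_of_injective ι ι.injective
    refine ⟨⟨⟨K.index - 1, by omega⟩, ⟨K, ?_⟩, ι, φ, hφ⟩, ?_⟩
    · simp only; omega
    · change (φ, φ 1 p) = (φ, p)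
      rw [map_one, Equiv.Perm.one_apply]

lemma card_mul_actionWeight [Group.FG G] (n : ℕ)
    (hfin : ∀ j, Finite {K : Subgroup G // K.index = j + 1}) (x : ℝ) :
    n * actionWeight G (Fin n) x = x * ∑ j ∈ Finset.range n,
      aCount G (j + 1) * n.descFactorial (j + 1) * actionWeight G (Fin (n - (j + 1))) x := by
  classical
  have := fun j => Fintype.ofFinite {K : Subgroup G // K.index = j + 1}
  have := Fintype.ofFinite (G →* Equiv.Perm (Fin n))
  have hq : ∀ (j : ℕ) (K : {K : Subgroup G // K.index = j + 1}), Finite (G ⧸ K.1) := by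
    intro j K
    refine Nat.finite_of_card_ne_zero ?_
    rw [← Subgroup.index_eq_card, K.2]
    omega
  have := fun j K => Fintype.ofFinite (G ⧸ (K : {K : Subgroup G // K.index = j + 1}).1)
  have h1 : n * actionWeight G (Fin n) x =
      ∑ s : (G →* Equiv.Perm (Fin n)) × Fin n, x ^ orbitCount s.1 := by
    rw [actionWeight, finsum_eq_sum_of_fintype, Fintype.sum_prod_type_right]
    simp
  rw [h1, ← (Equiv.ofBijective _ (pointed_bijective (G := G) n)).sum_comp]
  simp only [Equiv.ofBijective_apply, Fintype.sum_sigma]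
  rw [Finset.mul_sum, ← Fin.sum_univ_eq_sum_range (fun j => x * (aCount G (j + 1) *
    n.descFactorial (j + 1) * actionWeight G (Fin (n - (j + 1))) x))]
  refine Finset.sum_congr rfl fun j _ => ?_
  have h2 : ∀ K : {K : Subgroup G // K.index = j + 1}, ∀ ι : G ⧸ K.1 ↪ Fin n,
      ∑ φ : {φ : G →* Equiv.Perm (Fin n) // Extends ι φ}, x ^ orbitCount φ.1 =
        x * actionWeight G (Fin (n - (j + 1))) x := by
    intro K ι
    rw [← finsum_eq_sum_of_fintype, sum_extends, actionWeight_compl, K.2]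
  simp only [h2, Finset.sum_const, Finset.card_univ, Fintype.card_embedding_eq, nsmul_eq_mul,
    Fintype.card_fin]
  have h3 : ∀ K : {K : Subgroup G // K.index = j + 1}, Fintype.card (G ⧸ K.1) = j + 1 := by
    intro K
    rw [← Nat.card_eq_fintype_card, ← Subgroup.index_eq_card, K.2]
  simp only [h3, Finset.sum_const, Finset.card_univ, nsmul_eq_mul, aCount,
    Nat.card_eq_fintype_card]
  ring

/-- The normalised weights `h_n(x) = (1 / n!) ∑_φ x ^ c(φ)`. -/
noncomputable def normWeight (G : Type*) [Group G] (x : ℝ) (n : ℕ) : ℝ :=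
  actionWeight G (Fin n) x / n.factorial

lemma normWeight_rec [Group.FG G]
    (hfin : ∀ j, Finite {K : Subgroup G // K.index = j + 1}) (x : ℝ) (n : ℕ) :
    n * normWeight G x n = x * ∑ j ∈ Finset.range n,
      aCount G (j + 1) * normWeight G x (n - (j + 1)) := by
  rw [normWeight, ← mul_div_assoc, card_mul_actionWeight n hfin, mul_div_assoc, Finset.sum_div]
  congr 1
  refine Finset.sum_congr rfl fun j hj => ?_
  have hj : j + 1 ≤ n := Finset.mem_range.mp hj
  have h := Nat.factorial_mul_descFactorial hj
  have h' : ((n - (j + 1)).factorial : ℝ) * n.descFactorial (j + 1) = n.factorial := by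
    exact_mod_cast h
  have : ((n - (j + 1)).factorial : ℝ) ≠ 0 := by positivity
  have : (n.descFactorial (j + 1) : ℝ) ≠ 0 := by
    rw [Nat.cast_ne_zero, Ne, Nat.descFactorial_eq_zero_iff_lt]
    omega
  rw [normWeight]
  rw [← h']
  field_simp

lemma normWeight_pos [Group.FG G] {x : ℝ} (hx : 0 < x) (n : ℕ) : 0 < normWeight G x n := by
  refine div_pos ?_ (by positivity)
  have := Fintype.ofFinite (G →* Equiv.Perm (Fin n))
  rw [actionWeight, finsum_eq_sum_of_fintype]
  exact Finset.sum_pos (fun _ _ => by positivity) ⟨1, Finset.mem_univ _⟩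

lemma normWeight_zero [Group.FG G] (x : ℝ) : normWeight G x 0 = 1 := by
  have := Fintype.ofFinite (G →* Equiv.Perm (Fin 0))
  have h : ∀ φ : G →* Equiv.Perm (Fin 0), orbitCount φ = 0 := fun φ => by
    rw [orbitCount, Nat.card_eq_zero]
    exact Or.inl ⟨fun q => Quotient.inductionOn q fun a => a.elim0⟩
  have : Subsingleton (G →* Equiv.Perm (Fin 0)) :=
    ⟨fun f g => MonoidHom.ext fun _ => Subsingleton.elim _ _⟩
  rw [normWeight, actionWeight, finsum_eq_sum_of_fintype,
    Fintype.sum_subsingleton _ (1 : G →* Equiv.Perm (Fin 0)), h]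
  simp

/-- Jensen's inequality for the number of orbits. -/
lemma exp_mul_expVal_le [Group.FG G] {x : ℝ} (hx : 0 < x) (n : ℕ) (ε : ℝ) :
    Real.exp (ε * expVal G n x id) * normWeight G x n ≤ normWeight G (x * Real.exp ε) n := by
  have := Fintype.ofFinite (G →* Equiv.Perm (Fin n))
  have hw : expVal G n x id * actionWeight G (Fin n) x =
      ∑ φ : G →* Equiv.Perm (Fin n), orbitCount φ * x ^ orbitCount φ := by
    have h0 := normWeight_pos (G := G) hx n
    have h0' : actionWeight G (Fin n) x ≠ 0 := fun h => by simp [normWeight, h] at h0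
    have : expVal G n x id = (∑ᶠ φ : G →* Equiv.Perm (Fin n), (orbitCount φ : ℝ) *
      x ^ orbitCount φ) / actionWeight G (Fin n) x := rfl
    rw [this, div_mul_cancel₀ _ h0', finsum_eq_sum_of_fintype]
  rw [normWeight, normWeight, ← mul_div_assoc]
  gcongr
  set μ := expVal G n x id
  have hterm : ∀ φ : G →* Equiv.Perm (Fin n),
      Real.exp (ε * μ) * ((1 - ε * μ) * x ^ orbitCount φ +
        ε * (orbitCount φ * x ^ orbitCount φ)) ≤ (x * Real.exp ε) ^ orbitCount φ := by
    intro φ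
    have h := Real.add_one_le_exp (ε * orbitCount φ - ε * μ)
    have h2 : Real.exp (ε * orbitCount φ - ε * μ) * Real.exp (ε * μ) =
        Real.exp ε ^ orbitCount φ := by
      rw [← Real.exp_add, ← Real.exp_nat_mul]; ring_nf
    rw [mul_pow, ← h2]
    have := mul_le_mul_of_nonneg_left h
      (show 0 ≤ x ^ orbitCount φ * Real.exp (ε * μ) by positivity)
    nlinarith
  have hs := Finset.sum_le_sum fun φ (_ : φ ∈ Finset.univ) => hterm φ
  rw [← Finset.mul_sum, Finset.sum_add_distrib, ← Finset.mul_sum, ← Finset.mul_sum, ← hw] at hs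
  rw [actionWeight, actionWeight, finsum_eq_sum_of_fintype, finsum_eq_sum_of_fintype] at *
  refine le_trans (le_of_eq ?_) hs
  ring

end Combinatorics

section PowerSeries

open FormalMultilinearSeries in
lemma hasFPowerSeriesOnBall_tsum {a : ℕ → ℂ}
    (ha : ∀ r : ℝ, 0 < r → r < 1 → Summable fun n => ‖a n‖ * r ^ n) :
    HasFPowerSeriesOnBall (fun z => ∑' n, a n * z ^ n) (ofScalars ℂ a) 0 1 := by
  have hr : 1 ≤ (ofScalars ℂ a).radius := by
    refine ENNReal.le_of_forall_nnreal_lt fun r hr => ?_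
    have hr1 : (r : ℝ) < 1 := by exact_mod_cast hr
    rcases eq_or_ne r 0 with rfl | h0
    · simp
    refine le_radius_of_summable_norm _ ?_
    simpa only [ofScalars_norm] using ha r (by positivity) hr1
  have h := (ofScalars ℂ a).hasFPowerSeriesOnBall (lt_of_lt_of_le one_pos hr)
  refine (h.mono one_pos hr).congr fun z _ => ?_
  exact (ofScalars_sum_eq a z).trans (by simp)

lemma iteratedDeriv_tsum_zero {a : ℕ → ℂ}
    (ha : ∀ r : ℝ, 0 < r → r < 1 → Summable fun n => ‖a n‖ * r ^ n) (n : ℕ) :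
    iteratedDeriv n (fun z => ∑' n, a n * z ^ n) 0 = n.factorial * a n := by
  have h := hasFPowerSeriesOnBall_tsum ha
  have h2 := h.analyticAt.hasFPowerSeriesAt.eq_formalMultilinearSeries h.hasFPowerSeriesAt
  have h3 := congrFun ((FormalMultilinearSeries.ofScalars_series_eq_iff ℂ _ _).mp h2) n
  have : (n.factorial : ℂ) ≠ 0 := by exact_mod_cast n.factorial_ne_zero
  rw [← h3]
  field_simp

/-- The solution of `n h_n = x ∑ a_j h_{n-j}` has generating function `exp (x ∑ a_j z^j / j)`. -/
lemma hasSum_of_exp_rec {a h : ℕ → ℝ} {x : ℝ}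
    (hrec : ∀ n, n * h n = x * ∑ j ∈ Finset.range n, a j * h (n - (j + 1))) (h0 : h 0 = 1)
    (hs : ∀ r : ℝ, 0 < r → r < 1 → Summable fun j => |a j| / (j + 1) * r ^ (j + 1))
    {r : ℝ} (hr0 : 0 < r) (hr1 : r < 1) :
    HasSum (fun n => h n * r ^ n) (Real.exp (x * ∑' j, a j / (j + 1) * r ^ (j + 1))) := by
  set b : ℕ → ℂ := fun n => n.casesOn 0 fun j => ((a j / (j + 1) : ℝ) : ℂ) with hb
  have hbs : ∀ r : ℝ, 0 < r → r < 1 → Summable fun n => ‖b n‖ * r ^ n := by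
    intro r hr0 hr1
    rw [← summable_nat_add_iff 1]
    refine (hs r hr0 hr1).congr fun j => ?_
    simp only [hb, Complex.norm_real, Real.norm_eq_abs, abs_div]
    rw [abs_of_pos (by positivity : (0 : ℝ) < j + 1)]
  set A : ℂ → ℂ := fun z => ∑' n, b n * z ^ n with hA
  have hAs := hasFPowerSeriesOnBall_tsum hbs
  have hball : Metric.eball (0 : ℂ) 1 = Metric.ball 0 1 := by
    rw [← Metric.eball_ofReal]; simp
  have hAd : DifferentiableOn ℂ A (Metric.ball 0 1) := hball ▸ hAs.differentiableOn
  set g : ℂ → ℂ := fun z => Complex.exp (x * A z) with hg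
  have hgd : DifferentiableOn ℂ g (Metric.ball 0 1) := (hAd.const_mul _).cexp
  have h0mem : Metric.ball (0 : ℂ) 1 ∈ nhds (0 : ℂ) := Metric.ball_mem_nhds _ one_pos
  have hAan : AnalyticAt ℂ A 0 := hAs.analyticAt
  have hgan : AnalyticAt ℂ g 0 := hgd.analyticAt h0mem
  have hder : deriv g =ᶠ[nhds 0] ((fun z => (x : ℂ) * deriv A z) * g) := by
    filter_upwards [h0mem] with z hz
    have h1 := (hAd.differentiableAt (Metric.isOpen_ball.mem_nhds hz)).hasDerivAt
    have := ((h1.const_mul (x : ℂ)).cexp).deriv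
    rw [Pi.mul_apply, mul_comm]
    exact this
  have hcoef : ∀ n, iteratedDeriv n g 0 = n.factorial * h n := by
    intro n
    induction n using Nat.strong_induction_on with
    | _ n ih =>
      rcases n with _ | n
      · have : A 0 = 0 := by
          rw [hA]
          simp only
          rw [tsum_eq_single 0 (by intro n hn; simp [hn])]
          simp [hb]
        simp [hg, this, h0]
      · rw [iteratedDeriv_succ', hder.iteratedDeriv_eq, iteratedDeriv_mul
          (contDiffAt_const.mul hAan.deriv.contDiffAt) hgan.contDiffAt]
        have h1 : ∀ i, iteratedDeriv i (fun z => (x : ℂ) * deriv A z) 0 =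
            x * (i.factorial * a i) := by
          intro i
          rw [iteratedDeriv_const_mul_field, ← iteratedDeriv_succ', iteratedDeriv_tsum_zero hbs,
            Nat.factorial_succ]
          simp only [hb]
          push_cast
          have : (i : ℂ) + 1 ≠ 0 := by exact_mod_cast i.succ_ne_zero
          field_simp
        have h2 := congrArg (fun t : ℝ => (n.factorial : ℂ) * (t : ℂ)) (hrec (n + 1))
        rw [Nat.factorial_succ]
        push_cast at h2 ⊢
        rw [show ((n : ℂ) + 1) * n.factorial * h (n + 1) =
          n.factorial * (((n : ℂ) + 1) * h (n + 1)) by ring, h2, Finset.mul_sum, Finset.mul_sum]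
        refine Finset.sum_congr rfl fun i hi => ?_
        have hi : i ≤ n := Nat.lt_succ_iff.mp (Finset.mem_range.mp hi)
        rw [h1, ih (n - i) (by omega), ← Nat.choose_mul_factorial_mul_factorial hi]
        push_cast
        ring
  have hz : (r : ℂ) ∈ Metric.ball (0 : ℂ) 1 := by
    simp [abs_of_pos hr0, hr1]
  have hsum := Complex.hasSum_taylorSeries_on_ball hgd hz
  have hAr : A r = ((∑' j, a j / (j + 1) * r ^ (j + 1) : ℝ) : ℂ) := by
    have hsm : Summable fun n => b n * (r : ℂ) ^ n := by
      refine Summable.of_norm ((hbs r hr0 hr1).congr fun n => ?_)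
      simp [abs_of_pos hr0]
    rw [hA]
    simp only
    rw [hsm.tsum_eq_zero_add, Complex.ofReal_tsum]
    simp [hb]
  have hgr : g r = (Real.exp (x * ∑' j, a j / (j + 1) * r ^ (j + 1)) : ℝ) := by
    simp only [hg, hAr]
    push_cast
    rfl
  rw [← Complex.hasSum_ofReal, ← hgr]
  refine (congrArg (fun f => HasSum f (g r)) (funext fun n => ?_)).mpr hsum
  rw [hcoef]
  have : (n.factorial : ℂ) ≠ 0 := by exact_mod_cast n.factorial_ne_zero
  push_cast
  simp only [sub_zero, smul_eq_mul]
  field_simp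

end PowerSeries

section Saddle

open Filter Topology

lemma saddle_lt {s P β T τ : ℝ} (hβ : 0 < β) (hs : 0 < s) (hT : 0 < T) (hτ : 0 < τ)
    (hne : τ ≠ T) (hsaddle : β * (P * T ^ (-β)) = s * T) :
    s * T + P * T ^ (-β) < s * τ + P * τ ^ (-β) := by
  set y := τ / T with hy
  have hy0 : 0 < y := div_pos hτ hT
  have hy1 : y ≠ 1 := by
    rw [hy, Ne, div_eq_one_iff_eq hT.ne']
    exact hne
  have hτy : τ = y * T := by rw [hy]; field_simp
  have h1 : 1 - β * Real.log y ≤ y ^ (-β) := by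
    rw [Real.rpow_def_of_pos hy0]
    have := Real.add_one_le_exp (Real.log y * -β)
    linarith
  have h2 := Real.log_lt_sub_one_of_pos hy0 hy1
  rw [hτy, Real.mul_rpow hy0.le hT.le]
  have hQ : P * T ^ (-β) = s * T / β := by
    rw [← hsaddle]; field_simp
  have h3 : y ^ (-β) > 1 - β * (y - 1) := by nlinarith
  have h4 : P * (y ^ (-β) * T ^ (-β)) = s * T / β * y ^ (-β) := by rw [← hQ]; ring
  rw [h4, hQ]
  have h5 : 0 < s * T / β := by positivity
  have h6 : s * T = s * T / β * β := by field_simp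
  have h7 := mul_lt_mul_of_pos_left h3 h5
  nlinarith

lemma tendsto_log_coeff_div {h B u : ℕ → ℝ} {F : ℝ → ℝ} {c P β τ₀ : ℝ}
    (hpos : ∀ n, 0 < h n) (hc : 0 < c) (hcomp : ∀ n k, k < n → c * h k ≤ n * h n)
    (hF : ∀ t, 0 < t → HasSum (fun n => h n * Real.exp (-(n * t))) (Real.exp (F t)))
    (hu : ∀ᶠ n in atTop, 0 < u n) (hB : ∀ n, B n = n * u n)
    (hBlog : Tendsto (fun n : ℕ => Real.log n / B n) atTop (𝓝 0)) (hBtop : Tendsto B atTop atTop)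
    (hlim : ∀ τ, 0 < τ → Tendsto (fun n => F (τ * u n) / B n) atTop (𝓝 (P * τ ^ (-β))))
    (hβ : 0 < β) (hτ₀ : 0 < τ₀) (hsaddle : β * (P * τ₀ ^ (-β)) = τ₀) :
    Tendsto (fun n => Real.log (h n) / B n) atTop (𝓝 (τ₀ + P * τ₀ ^ (-β))) := by
  have hBpos : ∀ᶠ n in atTop, 0 < B n := hBtop.eventually_gt_atTop 0
  rw [tendsto_order]
  constructor
  · intro v hv
    have hcont : Tendsto (fun T : ℝ => P * ((τ₀ + T) / 2) ^ (-β) +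
        (τ₀ / T) ^ (β + 1) * ((τ₀ + T) / 2)) (𝓝[>] τ₀) (𝓝 (τ₀ + P * τ₀ ^ (-β))) := by
      have : ContinuousAt (fun T : ℝ => P * ((τ₀ + T) / 2) ^ (-β) +
          (τ₀ / T) ^ (β + 1) * ((τ₀ + T) / 2)) τ₀ := by
        refine ContinuousAt.add (continuousAt_const.mul (ContinuousAt.rpow_const (by fun_prop)
          (Or.inl (by positivity)))) (ContinuousAt.mul (ContinuousAt.rpow_const
          (ContinuousAt.div continuousAt_const continuousAt_id hτ₀.ne')
          (Or.inr (by positivity))) (by fun_prop))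
      have h2 := this.tendsto.mono_left (nhdsWithin_le_nhds (s := Set.Ioi τ₀))
      rw [div_self hτ₀.ne', Real.one_rpow, add_self_div_two, one_mul, add_comm (P * _)] at h2
      exact h2
    obtain ⟨T, hT, hτ₀T⟩ := ((hcont.eventually (lt_mem_nhds hv)).and self_mem_nhdsWithin).exists
    have hτ₀T : τ₀ < T := hτ₀T
    have hT0 : 0 < T := hτ₀.trans hτ₀T
    set τ := (τ₀ + T) / 2 with hτ
    set s := (τ₀ / T) ^ (β + 1) with hs
    have hτT : τ < T := by rw [hτ]; linarith
    have hτ₀τ : τ₀ < τ := by rw [hτ]; linarith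
    have hτ0 : 0 < τ := hτ₀.trans hτ₀τ
    have hs0 : 0 < s := Real.rpow_pos_of_pos (div_pos hτ₀ hT0) _
    have hgap1 : P * τ₀ ^ (-β) - (τ - τ₀) - P * τ ^ (-β) < 0 := by
      have := saddle_lt (s := 1) (P := P) hβ one_pos hτ₀ hτ0 hτ₀τ.ne'
        (by rw [one_mul]; exact hsaddle)
      linarith
    have hgap2 : P * T ^ (-β) + s * (T - τ) - P * τ ^ (-β) < 0 := by
      have hsT : β * (P * T ^ (-β)) = s * T := by
        have e1 : T ^ (-β) = τ₀ ^ (-β) * (τ₀ / T) ^ β := by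
          rw [Real.div_rpow hτ₀.le hT0.le, Real.rpow_neg hτ₀.le, Real.rpow_neg hT0.le]
          have := (Real.rpow_pos_of_pos hτ₀ β).ne'
          field_simp
        rw [hs, Real.rpow_add (div_pos hτ₀ hT0), Real.rpow_one, e1]
        calc _ = β * (P * τ₀ ^ (-β)) * (τ₀ / T) ^ β := by ring
          _ = _ := by rw [hsaddle]; field_simp
      have := saddle_lt hβ hs0 hT0 hτ0 hτT.ne hsT
      linarith
    have hsmall : ∀ (G : ℕ → ℝ) (l : ℝ), l < 0 → Tendsto (fun n => G n / B n) atTop (𝓝 l) →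
        ∀ᶠ n in atTop, Real.exp (G n) ≤ 1 / 4 := by
      intro G l hl hG
      have h1 : Tendsto (fun n => G n / B n * B n) atTop atBot := hG.neg_mul_atTop hl hBtop
      have h2 := (Real.tendsto_exp_atBot.comp h1).eventually
        (ge_mem_nhds (show (0 : ℝ) < 1 / 4 by norm_num))
      filter_upwards [h2, hBpos] with n hn hB
      simpa [div_mul_cancel₀ _ hB.ne'] using hn
    have hE1 := hsmall (fun n => F (τ₀ * u n) - (τ - τ₀) * B n - F (τ * u n)) _ hgap1 (by
      refine Tendsto.congr' ?_ (((hlim τ₀ hτ₀).sub_const (τ - τ₀)).sub (hlim τ hτ0))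
      filter_upwards [hBpos] with n hn
      field_simp)
    have hE2 := hsmall (fun n => F (T * u n) + s * (T - τ) * B n - F (τ * u n)) _ hgap2 (by
      refine Tendsto.congr' ?_ (((hlim T hT0).add_const (s * (T - τ))).sub (hlim τ hτ0))
      filter_upwards [hBpos] with n hn
      field_simp)
    have hlow : ∀ᶠ n : ℕ in atTop, F (τ * u n) / B n + s * τ +
        (Real.log (c / 2) / B n - 2 * (Real.log n / B n)) ≤ Real.log (h n) / B n := by
      filter_upwards [hE1, hE2, hu, hBpos, eventually_gt_atTop 0] with n hE1 hE2 hun hBn hn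
      have hn' : (0 : ℝ) < n := by exact_mod_cast hn
      set Q := n * h n / c * Real.exp (-(s * τ * B n)) with hQ
      have hQ0 : 0 ≤ Q := by have := hpos n; positivity
      have hfin : HasSum (fun k => if k < n then Q else 0) (n * Q) := by
        have := hasSum_sum_of_ne_finset_zero (L := .unconditional ℕ)
          (f := fun k => if k < n then Q else 0)
          (s := Finset.range n) (fun k hk => if_neg (by simpa using hk))
        convert this using 1
        rw [Finset.sum_congr rfl fun k hk => if_pos (Finset.mem_range.mp hk)]
        simp
      have hsum := (((hF (τ₀ * u n) (by positivity)).mul_right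
        (Real.exp (-((τ - τ₀) * B n)))).add ((hF (T * u n) (by positivity)).mul_right
        (Real.exp (s * (T - τ) * B n)))).add hfin
      suffices hterm : ∀ k : ℕ, h k * Real.exp (-(k * (τ * u n))) ≤
          h k * Real.exp (-(k * (τ₀ * u n))) * Real.exp (-((τ - τ₀) * B n)) +
          h k * Real.exp (-(k * (T * u n))) * Real.exp (s * (T - τ) * B n) +
          if k < n then Q else 0 by
        have hle := hasSum_le hterm (hF (τ * u n) (by positivity)) hsum
        have hx0 := Real.exp_pos (F (τ * u n))
        have e1 : Real.exp (F (τ₀ * u n)) * Real.exp (-((τ - τ₀) * B n)) ≤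
            1 / 4 * Real.exp (F (τ * u n)) := by
          rw [← Real.exp_add, show F (τ₀ * u n) + -((τ - τ₀) * B n) =
            (F (τ₀ * u n) - (τ - τ₀) * B n - F (τ * u n)) + F (τ * u n) by ring, Real.exp_add]
          exact mul_le_mul_of_nonneg_right hE1 hx0.le
        have e2 : Real.exp (F (T * u n)) * Real.exp (s * (T - τ) * B n) ≤
            1 / 4 * Real.exp (F (τ * u n)) := by
          rw [← Real.exp_add, show F (T * u n) + s * (T - τ) * B n =
            (F (T * u n) + s * (T - τ) * B n - F (τ * u n)) + F (τ * u n) by ring, Real.exp_add]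
          exact mul_le_mul_of_nonneg_right hE2 hx0.le
        have e3 : 1 / 2 * Real.exp (F (τ * u n)) ≤ n * Q := by linarith
        have e4 : c / 2 * Real.exp (F (τ * u n)) * Real.exp (s * τ * B n) ≤ n ^ 2 * h n := by
          have : Real.exp (-(s * τ * B n)) * Real.exp (s * τ * B n) = 1 := by
            rw [← Real.exp_add]; simp
          calc _ = c * (1 / 2 * Real.exp (F (τ * u n))) * Real.exp (s * τ * B n) := by ring
            _ ≤ c * (n * Q) * Real.exp (s * τ * B n) := by gcongr
            _ = n ^ 2 * h n * (Real.exp (-(s * τ * B n)) * Real.exp (s * τ * B n)) := by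
              rw [hQ]; field_simp
            _ = _ := by rw [this, mul_one]
        have e5 := Real.log_le_log (by positivity) e4
        rw [Real.log_mul (by positivity) (by positivity), Real.log_mul (by positivity)
          (by positivity), Real.log_exp, Real.log_exp, Real.log_mul (by positivity)
          (hpos n).ne', Real.log_pow] at e5
        rw [le_div_iff₀ hBn]
        push_cast at e5
        have : (F (τ * u n) / B n + s * τ + (Real.log (c / 2) / B n - 2 * (Real.log n / B n)))
          * B n = F (τ * u n) + s * τ * B n + Real.log (c / 2) - 2 * Real.log n := by
          field_simp; ring
        linarith
      · intro k
        have hk := hpos k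
        have key : ∀ θ : ℝ, h k * Real.exp (-(k * (τ * u n))) =
            h k * Real.exp (-(k * (θ * u n))) * Real.exp (k * (θ - τ) * u n) := by
          intro θ
          rw [mul_assoc, ← Real.exp_add]
          ring_nf
        have p1 : 0 ≤ h k * Real.exp (-(k * (τ₀ * u n))) * Real.exp (-((τ - τ₀) * B n)) := by
          positivity
        have p2 : 0 ≤ h k * Real.exp (-(k * (T * u n))) * Real.exp (s * (T - τ) * B n) := by
          positivity
        by_cases hkn : k < n
        · rw [if_pos hkn]
          by_cases hks : (k : ℝ) ≤ s * n
          · have : h k * Real.exp (-(k * (τ * u n))) ≤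
                h k * Real.exp (-(k * (T * u n))) * Real.exp (s * (T - τ) * B n) := by
              rw [key T]
              refine mul_le_mul_of_nonneg_left (Real.exp_le_exp.mpr ?_) (by positivity)
              rw [hB]
              have : 0 ≤ (T - τ) * u n := mul_nonneg (by linarith) hun.le
              nlinarith
            linarith
          · have : h k * Real.exp (-(k * (τ * u n))) ≤ Q := by
              rw [hQ]
              refine mul_le_mul ?_ (Real.exp_le_exp.mpr ?_) (by positivity)
                (by have := hpos n; positivity)
              · rw [le_div_iff₀ hc]
                linarith [hcomp n k hkn]
              · rw [hB]
                have : 0 ≤ τ * u n := by positivity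
                nlinarith
            linarith
        · rw [if_neg hkn]
          have hkn' : (n : ℝ) ≤ k := by exact_mod_cast not_lt.mp hkn
          have : h k * Real.exp (-(k * (τ * u n))) ≤
              h k * Real.exp (-(k * (τ₀ * u n))) * Real.exp (-((τ - τ₀) * B n)) := by
            rw [key τ₀]
            refine mul_le_mul_of_nonneg_left (Real.exp_le_exp.mpr ?_) (by positivity)
            rw [hB]
            have : 0 ≤ (τ - τ₀) * u n := mul_nonneg (by linarith) hun.le
            nlinarith
          linarith
    have hl : Tendsto (fun n : ℕ => F (τ * u n) / B n + s * τ +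
        (Real.log (c / 2) / B n - 2 * (Real.log n / B n))) atTop (𝓝 (P * τ ^ (-β) + s * τ)) := by
      have := ((hlim τ hτ0).add_const (s * τ)).add
        ((hBtop.const_div_atTop (Real.log (c / 2))).sub (hBlog.const_mul 2))
      simpa using this
    filter_upwards [hlow, hl.eventually (lt_mem_nhds hT)] with n h1 h2
    exact h2.trans_le h1
  · intro v hv
    have hl : Tendsto (fun n => τ₀ + F (τ₀ * u n) / B n) atTop (𝓝 (τ₀ + P * τ₀ ^ (-β))) :=
      (hlim τ₀ hτ₀).const_add τ₀
    filter_upwards [hu, hBpos, hl.eventually (gt_mem_nhds hv)] with n hun hBn hv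
    refine lt_of_le_of_lt ?_ hv
    rw [div_le_iff₀ hBn]
    have h1 := le_hasSum (hF (τ₀ * u n) (by positivity)) n fun k _ => by
      have := hpos k; positivity
    have h2 := Real.log_le_log (by have := hpos n; positivity) h1
    rw [Real.log_exp, Real.log_mul (hpos n).ne' (by positivity), Real.log_exp] at h2
    have : (τ₀ + F (τ₀ * u n) / B n) * B n = τ₀ * B n + F (τ₀ * u n) := by field_simp
    rw [this, hB]
    linarith

/-- Limits of convex functions may be differentiated. -/
lemma tendsto_div_of_subgradient {μ B : ℕ → ℝ} {ℓ : ℕ → ℝ → ℝ} {L : ℝ → ℝ} {L' : ℝ}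
    (hsub : ∀ n ε, ε * μ n + ℓ n 0 ≤ ℓ n ε) (hB : ∀ᶠ n in atTop, 0 < B n)
    (hℓ : ∀ ε, Tendsto (fun n => ℓ n ε / B n) atTop (𝓝 (L ε))) (hL : HasDerivAt L L' 0) :
    Tendsto (fun n => μ n / B n) atTop (𝓝 L') := by
  have hq : ∀ ε, Tendsto (fun n => (ℓ n ε / B n - ℓ n 0 / B n) / ε) atTop
      (𝓝 ((L ε - L 0) / ε)) := fun ε => ((hℓ ε).sub (hℓ 0)).div_const ε
  have hslope : Tendsto (fun ε => (L ε - L 0) / ε) (𝓝[≠] 0) (𝓝 L') := by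
    refine (hasDerivAt_iff_tendsto_slope.mp hL).congr fun ε => ?_
    simp [slope_def_field]
  have hbound : ∀ ε n, 0 < B n → ε * (μ n / B n) ≤ ℓ n ε / B n - ℓ n 0 / B n := by
    intro ε n hn
    rw [← sub_div, ← mul_div_assoc]
    gcongr
    linarith [hsub n ε]
  rw [tendsto_order]
  constructor
  · intro v hv
    obtain ⟨ε, h1, h2⟩ := (((hslope.mono_left (nhdsWithin_mono (0 : ℝ)
      (s := Set.Iio 0) (t := {0}ᶜ) (fun y (hy : y < 0) => hy.ne))).eventually
        (lt_mem_nhds hv)).and self_mem_nhdsWithin).exists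
    have h2 : ε < 0 := h2
    filter_upwards [hB, (hq ε).eventually (lt_mem_nhds h1)] with n hn h3
    refine h3.trans_le ?_
    rw [div_le_iff_of_neg h2]
    linarith [hbound ε n hn]
  · intro v hv
    obtain ⟨ε, h1, h2⟩ := (((hslope.mono_left (nhdsWithin_mono (0 : ℝ)
      (s := Set.Ioi 0) (t := {0}ᶜ) (fun y (hy : 0 < y) => hy.ne'))).eventually
        (gt_mem_nhds hv)).and self_mem_nhdsWithin).exists
    have h2 : 0 < ε := h2
    filter_upwards [hB, (hq ε).eventually (gt_mem_nhds h1)] with n hn h3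
    refine lt_of_le_of_lt ?_ h3
    rw [le_div_iff₀ h2]
    linarith [hbound ε n hn]

end Saddle

section Scale

open Filter Topology

/-- The saddle point scale `n ^ (-1/α) * (log n) ^ (M/α)`. -/
noncomputable def saddleScale (α : ℝ) (M : ℕ) (y : ℝ) : ℝ :=
  y ^ (-(1 / α)) * Real.log y ^ (M / α)

lemma saddleScale_pos (α : ℝ) (M : ℕ) {y : ℝ} (hy : 1 < y) : 0 < saddleScale α M y :=
  mul_pos (Real.rpow_pos_of_pos (by linarith) _) (Real.rpow_pos_of_pos (Real.log_pos hy) _)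

lemma tendsto_saddleScale {α : ℝ} (hα : 0 < α) (M : ℕ) :
    Tendsto (saddleScale α M) atTop (𝓝 0) := by
  have h := (isLittleO_log_rpow_rpow_atTop (M / α) (show 0 < 1 / α by positivity)).tendsto_div_nhds_zero
  refine h.congr' ?_
  filter_upwards [eventually_gt_atTop 0] with y hy
  rw [saddleScale, Real.rpow_neg hy.le, div_eq_mul_inv, mul_comm]

lemma mul_saddleScale {α : ℝ} (M : ℕ) {y : ℝ} (hy : 0 < y) :
    y * saddleScale α M y = y ^ (1 - 1 / α) * Real.log y ^ (M / α) := by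
  rw [saddleScale, ← mul_assoc, sub_eq_add_neg, Real.rpow_add hy, Real.rpow_one]

lemma rpow_le_mul_saddleScale {α : ℝ} (hα : 0 < α) (M : ℕ) :
    ∀ᶠ y : ℝ in atTop, y ^ (1 - 1 / α) ≤ y * saddleScale α M y := by
  filter_upwards [eventually_gt_atTop 0, Real.tendsto_log_atTop.eventually_ge_atTop 1] with y hy hl
  rw [mul_saddleScale M hy]
  exact le_mul_of_one_le_right (by positivity) (Real.one_le_rpow hl (by positivity))

lemma tendsto_mul_saddleScale {α : ℝ} (hα : 1 < α) (M : ℕ) :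
    Tendsto (fun y => y * saddleScale α M y) atTop atTop := by
  have : 0 < 1 - 1 / α := by
    rw [sub_pos, div_lt_one (by linarith)]; exact hα
  exact tendsto_atTop_mono' _ (rpow_le_mul_saddleScale (by linarith) M) (tendsto_rpow_atTop this)

lemma tendsto_log_div_mul_saddleScale {α : ℝ} (hα : 1 < α) (M : ℕ) :
    Tendsto (fun y => Real.log y / (y * saddleScale α M y)) atTop (𝓝 0) := by
  have h0 : 0 < 1 - 1 / α := by
    rw [sub_pos, div_lt_one (by linarith)]; exact hα
  have h := (isLittleO_log_rpow_atTop h0).tendsto_div_nhds_zero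
  refine tendsto_of_tendsto_of_tendsto_of_le_of_le' tendsto_const_nhds h ?_ ?_
  · filter_upwards [eventually_gt_atTop 1] with y hy
    have := saddleScale_pos α M hy
    have := Real.log_pos hy
    positivity
  · filter_upwards [eventually_gt_atTop 1, rpow_le_mul_saddleScale (α := α) (by linarith) M] with y hy h1
    have := Real.log_pos hy
    gcongr

lemma saddleScale_rpow {α : ℝ} (hα : 0 < α) (M : ℕ) {y : ℝ} (hy : 1 < y) :
    saddleScale α M y ^ (-(α - 1)) * Real.log y ^ M = y * saddleScale α M y := by
  have hs := saddleScale_pos α M hy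
  have hl := Real.log_pos hy
  have hy0 : 0 < y := by linarith
  have h1 : saddleScale α M y ^ α = y⁻¹ * Real.log y ^ M := by
    rw [saddleScale, Real.mul_rpow (by positivity) (by positivity), ← Real.rpow_mul hy0.le,
      ← Real.rpow_mul hl.le, div_mul_cancel₀ _ hα.ne', Real.rpow_natCast, neg_mul,
      div_mul_cancel₀ _ hα.ne', Real.rpow_neg_one]
  rw [neg_sub, sub_eq_add_neg, Real.rpow_add hs, Real.rpow_one, Real.rpow_neg hs.le, h1]
  field_simp

lemma tendsto_log_saddleScale_div {α : ℝ} (hα : 0 < α) (M : ℕ) {τ : ℝ} (hτ : 0 < τ) :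
    Tendsto (fun y => Real.log (1 / (τ * saddleScale α M y)) / Real.log y) atTop (𝓝 (1 / α)) := by
  have h1 : Tendsto (fun y => Real.log (Real.log y) / Real.log y) atTop (𝓝 0) := by
    have := Real.isLittleO_log_id_atTop.tendsto_div_nhds_zero.comp Real.tendsto_log_atTop
    exact this
  have h2 : Tendsto (fun y => -Real.log τ / Real.log y + 1 / α
      - M / α * (Real.log (Real.log y) / Real.log y)) atTop (𝓝 (0 + 1 / α - M / α * 0)) :=
    ((Real.tendsto_log_atTop.const_div_atTop _).add_const _).sub (h1.const_mul _)
  rw [mul_zero, sub_zero, zero_add] at h2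
  refine h2.congr' ?_
  filter_upwards [eventually_gt_atTop 1] with y hy
  have hl := Real.log_pos hy
  have hy0 : 0 < y := by linarith
  rw [one_div (τ * _), Real.log_inv, Real.log_mul hτ.ne' (saddleScale_pos α M hy).ne', saddleScale,
    Real.log_mul (by positivity) (by positivity), Real.log_rpow hy0, Real.log_rpow hl]
  field_simp
  ring

lemma tendsto_comp_saddleScale {A : ℝ → ℝ} {α K : ℝ} (hα : 0 < α) (M : ℕ)
    (hA : Tendsto (fun t => A t / (t ^ (-(α - 1)) * Real.log (1 / t) ^ M)) (𝓝[>] 0) (𝓝 K))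
    {τ : ℝ} (hτ : 0 < τ) :
    Tendsto (fun y => A (τ * saddleScale α M y) / (y * saddleScale α M y)) atTop
      (𝓝 (K * (1 / α) ^ M * τ ^ (-(α - 1)))) := by
  have h0 : Tendsto (fun y => τ * saddleScale α M y) atTop (𝓝[>] 0) := by
    refine tendsto_nhdsWithin_iff.mpr ⟨?_, ?_⟩
    · simpa using (tendsto_saddleScale hα M).const_mul τ
    · filter_upwards [eventually_gt_atTop 1] with y hy
      exact mul_pos hτ (saddleScale_pos α M hy)
  have hl := tendsto_log_saddleScale_div hα M hτ
  refine (((hA.comp h0).mul (hl.pow M)).mul_const (τ ^ (-(α - 1)))).congr' ?_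
  filter_upwards [eventually_gt_atTop 1, hl.eventually (lt_mem_nhds
    (show 0 < 1 / α by positivity))] with y hy hpos
  have hs := saddleScale_pos α M hy
  have hly := Real.log_pos hy
  have hpos : Real.log (1 / (τ * saddleScale α M y)) ≠ 0 := by
    intro h
    rw [h, zero_div] at hpos
    exact hpos.false
  rw [← saddleScale_rpow hα M hy]
  simp only [Function.comp]
  rw [Real.mul_rpow hτ.le hs.le, div_pow]
  have := Real.rpow_pos_of_pos hτ (-(α - 1))
  have := Real.rpow_pos_of_pos hs (-(α - 1))
  field_simp

end Scale

section Bandlimited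

open Filter Topology MeasureTheory Complex

/-- `F` is a nonnegative kernel, with `M` moments, whose Fourier transform `ψ` is continuous and
compactly supported. -/
structure IsBandlimitedKernel (M : ℕ) (F : ℝ → ℝ) (ψ : ℝ → ℂ) : Prop where
  nonneg : ∀ v, 0 ≤ F v
  continuous_symbol : Continuous ψ
  compact : HasCompactSupport ψ
  eq : ∀ v : ℝ, (F v : ℂ) = ∫ y : ℝ, cexp (((-2 * Real.pi * y * v : ℝ) : ℂ) * I) * ψ y
  moment : Integrable fun v => (1 + |v|) ^ M * F v

lemma norm_exp_mul_I_mul (r : ℝ) (z : ℂ) : ‖cexp ((r : ℂ) * I) * z‖ = ‖z‖ := by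
  rw [norm_mul, norm_exp_ofReal_mul_I, one_mul]

lemma integrableOn_pow_mul_exp_neg {ε : ℝ} (hε : 0 < ε) (j : ℕ) :
    IntegrableOn (fun u : ℝ => u ^ j * Real.exp (-(ε * u))) (Set.Ioi 0) := by
  have := integrableOn_rpow_mul_exp_neg_mul_rpow (s := j) (p := 1) (b := ε)
    (by have : (0 : ℝ) ≤ j := Nat.cast_nonneg j
        linarith) one_pos hε
  simpa using this

lemma integrableOn_pow_mul_cexp_neg {z : ℂ} (hz : 0 < z.re) (j : ℕ) :
    IntegrableOn (fun u : ℝ => (u : ℂ) ^ j * cexp (-(z * u))) (Set.Ioi 0) := by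
  refine Integrable.mono (integrableOn_pow_mul_exp_neg hz j)
    (by fun_prop : Continuous fun u : ℝ => (u : ℂ) ^ j * cexp (-(z * u))).aestronglyMeasurable
    (Eventually.of_forall fun u => ?_)
  simp [Complex.norm_exp]

lemma integral_pow_mul_cexp_neg {z : ℂ} (hz : 0 < z.re) (j : ℕ) :
    ∫ u in Set.Ioi (0 : ℝ), (u : ℂ) ^ j * cexp (-(z * u)) = j.factorial / z ^ (j + 1) := by
  have hz0 : z ≠ 0 := fun h => by simp [h] at hz
  have hexp : ∀ u : ℝ, HasDerivAt (fun u : ℝ => cexp (-(z * u))) (-z * cexp (-(z * u))) u := by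
    intro u
    have h1 : HasDerivAt (fun u : ℝ => -(z * (u : ℂ))) (-z) u := by
      simpa using ((hasDerivAt_id u).ofReal_comp.const_mul z).fun_neg
    simpa [mul_comm] using h1.cexp
  have hlim : ∀ j : ℕ, Tendsto (fun u : ℝ => (u : ℂ) ^ j * cexp (-(z * u))) atTop (𝓝 0) := by
    intro j
    rw [tendsto_zero_iff_norm_tendsto_zero]
    have h1 := Real.tendsto_pow_mul_exp_neg_atTop_nhds_zero j
    have h2 := (h1.comp (tendsto_id.const_mul_atTop hz)).const_mul ((z.re ^ j)⁻¹)
    rw [mul_zero] at h2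
    refine h2.congr' ?_
    filter_upwards [eventually_ge_atTop 0] with u hu
    simp [Complex.norm_exp, mul_pow, abs_of_nonneg hu]
    field_simp
  induction j with
  | zero =>
    have h1 := integral_Ioi_of_hasDerivAt_of_tendsto' (a := 0) (fun u _ => hexp u)
      (Integrable.const_mul (by simpa [IntegrableOn] using integrableOn_pow_mul_cexp_neg hz 0) (-z))
      (by simpa using hlim 0)
    rw [integral_const_mul] at h1
    simp only [ofReal_zero, mul_zero, neg_zero, Complex.exp_zero, zero_sub] at h1
    simp only [pow_zero, one_mul, Nat.factorial_zero, Nat.cast_one, zero_add, pow_one]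
    rw [eq_div_iff hz0]
    linear_combination -h1
  | succ j ih =>
    have hd : ∀ u : ℝ, HasDerivAt (fun u : ℝ => (u : ℂ) ^ (j + 1) * cexp (-(z * u)))
        ((j + 1) * ((u : ℂ) ^ j * cexp (-(z * u))) -
          z * ((u : ℂ) ^ (j + 1) * cexp (-(z * u)))) u := by
      intro u
      have h1 : HasDerivAt (fun u : ℝ => (u : ℂ) ^ (j + 1)) ((j + 1) * (u : ℂ) ^ j) u := by
        simpa using (hasDerivAt_id u).ofReal_comp.fun_pow (j + 1)
      exact (h1.fun_mul (hexp u)).congr_deriv (by ring)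
    have i1 := (integrableOn_pow_mul_cexp_neg hz j).const_mul ((j : ℂ) + 1)
    have i2 := (integrableOn_pow_mul_cexp_neg hz (j + 1)).const_mul z
    have h1 := integral_Ioi_of_hasDerivAt_of_tendsto' (a := 0) (fun u _ => hd u)
      (i1.sub i2) (hlim (j + 1))
    rw [integral_sub i1 i2, integral_const_mul, integral_const_mul, ih] at h1
    simp only [ofReal_zero, ne_eq, Nat.add_eq_zero_iff, one_ne_zero, and_false, not_false_eq_true,
      zero_pow, zero_mul, sub_zero] at h1
    rw [Nat.factorial_succ, pow_succ z, eq_div_iff (by positivity)]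
    push_cast
    have : z ^ (j + 1) * (j.factorial / z ^ (j + 1)) = j.factorial := by field_simp
    linear_combination -z ^ (j + 1) * h1 + (j + 1) * this

namespace IsBandlimitedKernel

variable {M : ℕ} {F : ℝ → ℝ} {ψ : ℝ → ℂ}

lemma integrable_symbol (h : IsBandlimitedKernel M F ψ) : Integrable ψ :=
  h.continuous_symbol.integrable_of_hasCompactSupport h.compact

lemma continuous (h : IsBandlimitedKernel M F ψ) : Continuous F := by
  have h1 : Continuous fun v : ℝ => ∫ y : ℝ, cexp (((-2 * Real.pi * y * v : ℝ) : ℂ) * I) * ψ y := by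
    refine continuous_of_dominated (bound := fun y => ‖ψ y‖) (fun v => ?_) (fun v => ?_)
      h.integrable_symbol.norm ?_
    · exact (Continuous.mul (by fun_prop) h.continuous_symbol).aestronglyMeasurable
    · exact Eventually.of_forall fun y => (norm_exp_mul_I_mul _ _).le
    · exact Eventually.of_forall fun y => by fun_prop
  have h2 : F = fun v => (∫ y : ℝ, cexp (((-2 * Real.pi * y * v : ℝ) : ℂ) * I) * ψ y).re := by
    ext v
    rw [← h.eq, ofReal_re]
  rw [h2]
  exact continuous_re.comp h1

lemma hasSum_dirichlet (h : IsBandlimitedKernel M F ψ) {a : ℕ → ℂ} {σ : ℝ}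
    (hs : Summable fun j : ℕ => ‖a j * ((j + 1 : ℕ) : ℂ) ^ (-(σ : ℂ))‖) (U : ℝ) :
    HasSum (fun j : ℕ => a j * ((j + 1 : ℕ) : ℂ) ^ (-(σ : ℂ)) * F (Real.log (j + 1) - U))
      (∫ y : ℝ, cexp ((2 * Real.pi * y * U : ℝ) * I) * ψ y *
        ∑' j : ℕ, a j * ((j + 1 : ℕ) : ℂ) ^ (-(σ + (2 * Real.pi * y : ℝ) * I))) := by
  have hψ := h.integrable_symbol
  have hcpow : ∀ (j : ℕ) (y : ℝ), ((j + 1 : ℕ) : ℂ) ^ (-(σ + (2 * Real.pi * y : ℝ) * I)) =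
      ((j + 1 : ℕ) : ℂ) ^ (-(σ : ℂ)) *
        cexp (((-2 * Real.pi * y * Real.log (j + 1) : ℝ) : ℂ) * I) := by
    intro j y
    have hj : ((j + 1 : ℕ) : ℂ) ≠ 0 := by exact_mod_cast Nat.succ_ne_zero j
    rw [neg_add, cpow_add _ _ hj, cpow_def_of_ne_zero hj (-((2 * Real.pi * y : ℝ) * I)),
      ← ofReal_natCast, ← ofReal_log (Nat.cast_nonneg _)]
    congr 2
    push_cast
    ring
  have key : ∀ (j : ℕ) (y : ℝ), cexp ((2 * Real.pi * y * U : ℝ) * I) * ψ y *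
      (a j * ((j + 1 : ℕ) : ℂ) ^ (-(σ + (2 * Real.pi * y : ℝ) * I))) =
      a j * ((j + 1 : ℕ) : ℂ) ^ (-(σ : ℂ)) *
        (cexp (((-2 * Real.pi * y * (Real.log (j + 1) - U) : ℝ) : ℂ) * I) * ψ y) := by
    intro j y
    rw [hcpow]
    have : cexp (((-2 * Real.pi * y * (Real.log (j + 1) - U) : ℝ) : ℂ) * I) =
        cexp (((-2 * Real.pi * y * Real.log (j + 1) : ℝ) : ℂ) * I) *
        cexp ((2 * Real.pi * y * U : ℝ) * I) := by
      rw [← Complex.exp_add]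
      congr 1
      push_cast
      ring
    rw [this]
    ring
  have hnorm : ∀ (j : ℕ) (y : ℝ), ‖a j * ((j + 1 : ℕ) : ℂ) ^ (-(σ : ℂ)) *
        (cexp (((-2 * Real.pi * y * (Real.log (j + 1) - U) : ℝ) : ℂ) * I) * ψ y)‖ =
        ‖a j * ((j + 1 : ℕ) : ℂ) ^ (-(σ : ℂ))‖ * ‖ψ y‖ := by
    intro j y
    rw [norm_mul, norm_exp_mul_I_mul]
  have h1 := hasSum_integral_of_summable_integral_norm (μ := volume) (F := fun (j : ℕ) (y : ℝ) =>
    cexp ((2 * Real.pi * y * U : ℝ) * I) * ψ y *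
      (a j * ((j + 1 : ℕ) : ℂ) ^ (-(σ + (2 * Real.pi * y : ℝ) * I)))) (fun j => by
      simp only [key]
      refine Integrable.const_mul ?_ _
      refine hψ.mono (Continuous.mul (by fun_prop) h.continuous_symbol).aestronglyMeasurable ?_
      exact Eventually.of_forall fun y => (norm_exp_mul_I_mul _ _).le) (by
      simp_rw [key, hnorm, integral_const_mul]
      exact hs.mul_right _)
  simp_rw [tsum_mul_left] at h1
  have h2 : ∀ j : ℕ, a j * ((j + 1 : ℕ) : ℂ) ^ (-(σ : ℂ)) * F (Real.log (j + 1) - U) = ∫ y : ℝ,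
      cexp ((2 * Real.pi * y * U : ℝ) * I) * ψ y *
        (a j * ((j + 1 : ℕ) : ℂ) ^ (-(σ + (2 * Real.pi * y : ℝ) * I))) := by
    intro j
    simp only [key]
    rw [integral_const_mul, h.eq]
  simpa only [h2] using h1

lemma setIntegral_pow_mul_exp (h : IsBandlimitedKernel M F ψ) {ε : ℝ} (hε : 0 < ε) (j : ℕ)
    (U : ℝ) :
    ((∫ u in Set.Ioi (0 : ℝ), u ^ j * Real.exp (-(ε * u)) * F (u - U) : ℝ) : ℂ) =
      ∫ y : ℝ, cexp ((2 * Real.pi * y * U : ℝ) * I) * ψ y *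
        (j.factorial / (ε + (2 * Real.pi * y : ℝ) * I) ^ (j + 1)) := by
  have hψ := h.integrable_symbol
  have hlap : ∀ y : ℝ, ∫ u in Set.Ioi (0 : ℝ), ((u ^ j * Real.exp (-(ε * u)) : ℝ) : ℂ) *
      cexp (((-2 * Real.pi * y * u : ℝ) : ℂ) * I) =
      j.factorial / (ε + (2 * Real.pi * y : ℝ) * I) ^ (j + 1) := by
    intro y
    rw [← integral_pow_mul_cexp_neg (by simpa using hε)]
    refine setIntegral_congr_fun measurableSet_Ioi fun u _ => ?_
    push_cast
    rw [mul_assoc, ← Complex.exp_add]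
    congr 2
    ring
  rw [← integral_complex_ofReal]
  simp_rw [← hlap, ← integral_const_mul]
  rw [integral_integral_swap]
  · refine integral_congr_ae (Eventually.of_forall fun u => ?_)
    dsimp only
    rw [ofReal_mul, h.eq, ← integral_const_mul]
    refine integral_congr_ae (Eventually.of_forall fun y => ?_)
    dsimp only
    have : cexp (((-2 * Real.pi * y * (u - U) : ℝ) : ℂ) * I) =
        cexp (((-2 * Real.pi * y * u : ℝ) : ℂ) * I) *
        cexp ((2 * Real.pi * y * U : ℝ) * I) := by
      rw [← Complex.exp_add]
      congr 1
      push_cast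
      ring
    rw [this]
    ring
  · refine (hψ.mul_prod (integrableOn_pow_mul_exp_neg hε j).ofReal).mono ?_
      (Eventually.of_forall fun p => ?_)
    · refine Continuous.aestronglyMeasurable (Continuous.mul (Continuous.mul (by fun_prop)
        (h.continuous_symbol.comp continuous_fst)) (by fun_prop))
    · simp only [Function.uncurry, norm_mul, norm_exp_ofReal_mul_I, one_mul, mul_one]
      exact le_rfl

end IsBandlimitedKernel

end Bandlimited

section BoundaryValue

open Filter Topology MeasureTheory Complex

/-- The Dirichlet series with coefficients `a (δ - 1)` converges absolutely for `Re s > α`, where it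
is the sum of the polar part `∑ κ j / (s - α) ^ (j + 1)`, of order at most `M + 1`, and of `Φ`,
which is continuous up to the line `Re s = α`. -/
structure HasPolarPart (a : ℕ → ℝ) (α : ℝ) (M : ℕ) (κ : ℕ → ℂ) (Φ : ℂ → ℂ) : Prop where
  nonneg : ∀ j, 0 ≤ a j
  continuousOn : ContinuousOn Φ {s : ℂ | α ≤ s.re}
  summable : ∀ s : ℂ, α < s.re → Summable fun j : ℕ => ‖(a j : ℂ) * ((j + 1 : ℕ) : ℂ) ^ (-s)‖
  eq : ∀ s : ℂ, α < s.re → ∑' j : ℕ, (a j : ℂ) * ((j + 1 : ℕ) : ℂ) ^ (-s) =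
    ∑ j ∈ Finset.range (M + 1), κ j / (s - α) ^ (j + 1) + Φ s

lemma one_add_abs_add_pow_le (M : ℕ) (x y : ℝ) :
    (1 + |x + y|) ^ M ≤ (1 + |x|) ^ M * (1 + |y|) ^ M := by
  rw [← mul_pow]
  gcongr
  have := abs_add_le x y
  nlinarith [abs_nonneg x, abs_nonneg y, mul_nonneg (abs_nonneg x) (abs_nonneg y)]

lemma pow_le_one_add_abs_pow {j M : ℕ} (hj : j ≤ M) (x : ℝ) : |x| ^ j ≤ (1 + |x|) ^ M := by
  have := abs_nonneg x
  exact (pow_le_pow_left₀ this (by linarith) j).trans (pow_le_pow_right₀ (by linarith) hj)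

namespace IsBandlimitedKernel

variable {M : ℕ} {F : ℝ → ℝ} {ψ : ℝ → ℂ}

lemma integrable_pow_mul (h : IsBandlimitedKernel M F ψ) {j : ℕ} (hj : j ≤ M) (U : ℝ) :
    Integrable fun u => u ^ j * F (u - U) := by
  have h1 := (h.moment.comp_sub_right U).const_mul ((1 + |U|) ^ M)
  have hc := h.continuous
  refine h1.mono (by fun_prop : Continuous fun u => u ^ j * F (u - U)).aestronglyMeasurable
    (Eventually.of_forall fun u => ?_)
  have h2 := one_add_abs_add_pow_le M U (u - U)
  have h3 := pow_le_one_add_abs_pow hj u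
  rw [add_sub_cancel] at h2
  have hF := h.nonneg (u - U)
  rw [norm_mul, norm_pow, Real.norm_eq_abs, Real.norm_of_nonneg hF, Real.norm_of_nonneg
    (by positivity), ← mul_assoc]
  exact mul_le_mul_of_nonneg_right (h3.trans h2) hF

lemma tendsto_laplace (h : IsBandlimitedKernel M F ψ) {j : ℕ} (hj : j ≤ M) (U : ℝ) :
    Tendsto (fun ε : ℝ => ∫ u in Set.Ioi (0 : ℝ), u ^ j * Real.exp (-(ε * u)) * F (u - U))
      (𝓝[>] 0) (𝓝 (∫ u in Set.Ioi (0 : ℝ), u ^ j * F (u - U))) := by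
  have hc := h.continuous
  refine tendsto_integral_filter_of_dominated_convergence (fun u => ‖u ^ j * F (u - U)‖) ?_ ?_
    (h.integrable_pow_mul hj U).norm.integrableOn ?_
  · exact Eventually.of_forall fun ε => (by fun_prop : Continuous fun u : ℝ =>
      u ^ j * Real.exp (-(ε * u)) * F (u - U)).aestronglyMeasurable
  · filter_upwards [self_mem_nhdsWithin] with ε hε
    refine (ae_restrict_mem measurableSet_Ioi).mono fun u hu => ?_
    have hε : 0 < ε := hε
    have hu : 0 < u := hu
    rw [mul_right_comm, norm_mul _ (Real.exp _), Real.norm_eq_abs (Real.exp _), Real.abs_exp]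
    refine mul_le_of_le_one_right (norm_nonneg _) (Real.exp_le_one_iff.mpr ?_)
    have := mul_pos hε hu
    linarith
  · refine Eventually.of_forall fun u => ?_
    have : ContinuousAt (fun ε : ℝ => u ^ j * Real.exp (-(ε * u)) * F (u - U)) 0 := by fun_prop
    have h2 := this.tendsto.mono_left (nhdsWithin_le_nhds (s := Set.Ioi 0))
    simpa using h2

variable {a : ℕ → ℝ} {α : ℝ} {κ : ℕ → ℂ} {Φ : ℂ → ℂ}

lemma continuous_boundary (hD : HasPolarPart a α M κ Φ) :
    Continuous fun p : ℝ × ℝ => Φ (α + (|p.1| : ℝ) + (2 * Real.pi * p.2 : ℝ) * I) := by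
  refine hD.continuousOn.comp_continuous (by fun_prop) fun p => ?_
  simp

lemma hasSum_of_pos (h : IsBandlimitedKernel M F ψ) (hD : HasPolarPart a α M κ Φ) {ε : ℝ}
    (hε : 0 < ε) (U : ℝ) :
    HasSum (fun j : ℕ => ((a j * ((j : ℝ) + 1) ^ (-(α + ε)) * F (Real.log (j + 1) - U) : ℝ) : ℂ))
      (∑ j ∈ Finset.range (M + 1), κ j / j.factorial *
        (∫ u in Set.Ioi (0 : ℝ), u ^ j * Real.exp (-(ε * u)) * F (u - U) : ℝ) +
      ∫ y : ℝ, cexp ((2 * Real.pi * y * U : ℝ) * I) * ψ y *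
        Φ (α + (|ε| : ℝ) + (2 * Real.pi * y : ℝ) * I)) := by
  have h1 := h.hasSum_dirichlet (a := fun j => (a j : ℂ)) (σ := α + ε)
    (hD.summable ((α + ε : ℝ) : ℂ) (by simpa using hε)) U
  have h2 : ∀ j : ℕ, ((a j * ((j : ℝ) + 1) ^ (-(α + ε)) * F (Real.log (j + 1) - U) : ℝ) : ℂ) =
      a j * ((j + 1 : ℕ) : ℂ) ^ (-((α + ε : ℝ) : ℂ)) * F (Real.log (j + 1) - U) := by
    intro j
    push_cast
    rw [ofReal_cpow (by positivity)]
    push_cast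
    rfl
  simp only [h2]
  convert h1 using 1
  have hz : ∀ y : ℝ, (ε : ℂ) + (2 * Real.pi * y : ℝ) * I ≠ 0 := by
    intro y hy
    have := congrArg re hy
    simp at this
    exact hε.ne' this
  have h3 : ∀ y : ℝ, cexp ((2 * Real.pi * y * U : ℝ) * I) * ψ y *
      ∑' j : ℕ, (a j : ℂ) * ((j + 1 : ℕ) : ℂ) ^ (-((α + ε : ℝ) + (2 * Real.pi * y : ℝ) * I)) =
      ∑ j ∈ Finset.range (M + 1), κ j / j.factorial *
        (cexp ((2 * Real.pi * y * U : ℝ) * I) * ψ y *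
          (j.factorial / (ε + (2 * Real.pi * y : ℝ) * I) ^ (j + 1))) +
      cexp ((2 * Real.pi * y * U : ℝ) * I) * ψ y *
        Φ (α + (|ε| : ℝ) + (2 * Real.pi * y : ℝ) * I) := by
    intro y
    rw [hD.eq _ (by simpa using hε), mul_add, Finset.mul_sum, abs_of_pos hε, ofReal_add]
    congr 1
    refine Finset.sum_congr rfl fun j _ => ?_
    have : (j.factorial : ℂ) ≠ 0 := by exact_mod_cast j.factorial_ne_zero
    rw [show (α : ℂ) + ε + (2 * Real.pi * y : ℝ) * I - α = ε + (2 * Real.pi * y : ℝ) * I by ring]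
    have := pow_ne_zero (j + 1) (hz y)
    field_simp
  simp only [h3]
  have hcψ := h.continuous_symbol
  have hΦ : Continuous fun y : ℝ => Φ (α + (|ε| : ℝ) + (2 * Real.pi * y : ℝ) * I) :=
    (continuous_boundary hD).comp (by fun_prop : Continuous fun y : ℝ => (ε, y))
  have hInt : ∀ g : ℝ → ℂ, Continuous g → Integrable fun y : ℝ =>
      cexp ((2 * Real.pi * y * U : ℝ) * I) * ψ y * g y := by
    intro g hg
    refine Continuous.integrable_of_hasCompactSupport (by fun_prop) ?_
    exact (h.compact.mul_left).mul_right
  have hInt2 : ∀ j : ℕ, Integrable fun y : ℝ => κ j / j.factorial *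
        (cexp ((2 * Real.pi * y * U : ℝ) * I) * ψ y *
          (j.factorial / (ε + (2 * Real.pi * y : ℝ) * I) ^ (j + 1))) := fun j =>
    (hInt _ (continuous_const.div (by fun_prop) fun y => pow_ne_zero _ (hz y))).const_mul _
  rw [integral_add (integrable_finsetSum _ fun j _ => hInt2 j) (hInt _ hΦ),
    integral_finsetSum _ fun j _ => hInt2 j]
  congr 1
  refine Finset.sum_congr rfl fun j _ => ?_
  rw [h.setIntegral_pow_mul_exp hε, integral_const_mul]

lemma tendsto_boundary (h : IsBandlimitedKernel M F ψ) (hD : HasPolarPart a α M κ Φ) (U : ℝ) :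
    Tendsto (fun ε : ℝ => ∑ j ∈ Finset.range (M + 1), κ j / j.factorial *
        (∫ u in Set.Ioi (0 : ℝ), u ^ j * Real.exp (-(ε * u)) * F (u - U) : ℝ) +
      ∫ y : ℝ, cexp ((2 * Real.pi * y * U : ℝ) * I) * ψ y *
        Φ (α + (|ε| : ℝ) + (2 * Real.pi * y : ℝ) * I)) (𝓝[>] 0)
      (𝓝 (∑ j ∈ Finset.range (M + 1), κ j / j.factorial *
        (∫ u in Set.Ioi (0 : ℝ), u ^ j * F (u - U) : ℝ) +
      ∫ y : ℝ, cexp ((2 * Real.pi * y * U : ℝ) * I) * ψ y *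
        Φ (α + (2 * Real.pi * y : ℝ) * I))) := by
  refine Tendsto.add (tendsto_finsetSum _ fun j hj => Tendsto.const_mul _ ?_) ?_
  · exact (continuous_ofReal.tendsto _).comp
      (h.tendsto_laplace (Nat.lt_succ_iff.mp (Finset.mem_range.mp hj)) U)
  · have hcψ := h.continuous_symbol
    have hcΦ := continuous_boundary hD
    have h1 := continuous_parametric_integral_of_continuous (μ := volume)
      (f := fun ε y : ℝ => cexp ((2 * Real.pi * y * U : ℝ) * I) * ψ y *
        Φ (α + (|ε| : ℝ) + (2 * Real.pi * y : ℝ) * I)) (s := tsupport ψ)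
      (by
        refine Continuous.mul (by fun_prop) hcΦ) h.compact
    have h2 : ∀ ε : ℝ, ∫ y in tsupport ψ, cexp ((2 * Real.pi * y * U : ℝ) * I) * ψ y *
        Φ (α + (|ε| : ℝ) + (2 * Real.pi * y : ℝ) * I) =
        ∫ y : ℝ, cexp ((2 * Real.pi * y * U : ℝ) * I) * ψ y *
        Φ (α + (|ε| : ℝ) + (2 * Real.pi * y : ℝ) * I) := fun ε =>
      setIntegral_eq_integral_of_forall_compl_eq_zero fun y hy => by
        rw [image_eq_zero_of_notMem_tsupport hy, mul_zero, zero_mul]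
    simp only [h2] at h1
    have h3 := (h1.tendsto 0).mono_left (nhdsWithin_le_nhds (s := Set.Ioi 0))
    simpa using h3

lemma hasSum_boundary (h : IsBandlimitedKernel M F ψ) (hD : HasPolarPart a α M κ Φ) (U : ℝ) :
    HasSum (fun j : ℕ => ((a j * ((j : ℝ) + 1) ^ (-α) * F (Real.log (j + 1) - U) : ℝ) : ℂ))
      (∑ j ∈ Finset.range (M + 1), κ j / j.factorial *
        (∫ u in Set.Ioi (0 : ℝ), u ^ j * F (u - U) : ℝ) +
      ∫ y : ℝ, cexp ((2 * Real.pi * y * U : ℝ) * I) * ψ y *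
        Φ (α + (2 * Real.pi * y : ℝ) * I)) := by
  have hlim := h.tendsto_boundary hD U
  set R₀ := ∑ j ∈ Finset.range (M + 1), κ j / j.factorial *
        (∫ u in Set.Ioi (0 : ℝ), u ^ j * F (u - U) : ℝ) +
      ∫ y : ℝ, cexp ((2 * Real.pi * y * U : ℝ) * I) * ψ y *
        Φ (α + (2 * Real.pi * y : ℝ) * I)
  set R := fun ε : ℝ => ∑ j ∈ Finset.range (M + 1), κ j / j.factorial *
        (∫ u in Set.Ioi (0 : ℝ), u ^ j * Real.exp (-(ε * u)) * F (u - U) : ℝ) +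
      ∫ y : ℝ, cexp ((2 * Real.pi * y * U : ℝ) * I) * ψ y *
        Φ (α + (|ε| : ℝ) + (2 * Real.pi * y : ℝ) * I)
  set f : ℝ → ℕ → ℝ := fun ε j => a j * ((j : ℝ) + 1) ^ (-(α + ε)) * F (Real.log (j + 1) - U)
    with hf
  have hsum : ∀ ε, 0 < ε → HasSum (fun j => (f ε j : ℂ)) (R ε) := fun ε hε =>
    h.hasSum_of_pos hD hε U
  have hf0 : ∀ ε j, 0 ≤ f ε j := fun ε j =>
    mul_nonneg (mul_nonneg (hD.nonneg j) (by positivity)) (h.nonneg _)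
  have hsumre : ∀ ε, 0 < ε → HasSum (f ε) (R ε).re := fun ε hε => by
    simpa using hasSum_re (hsum ε hε)
  have hft : ∀ j, Tendsto (fun ε => f ε j) (𝓝[>] 0) (𝓝 (f 0 j)) := by
    intro j
    have hj : (j : ℝ) + 1 ≠ 0 := by positivity
    have : ContinuousAt (fun ε => f ε j) 0 := by
      refine ContinuousAt.mul (ContinuousAt.mul continuousAt_const ?_) continuousAt_const
      exact ContinuousAt.rpow continuousAt_const (by fun_prop) (Or.inl hj)
    exact this.tendsto.mono_left nhdsWithin_le_nhds
  have hsum0 : Summable (f 0) := by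
    refine summable_of_sum_le (c := R₀.re) (hf0 0) fun s => ?_
    refine le_of_tendsto_of_tendsto (tendsto_finsetSum s fun j _ => hft j)
      ((continuous_re.tendsto _).comp hlim) ?_
    filter_upwards [self_mem_nhdsWithin] with ε hε
    exact sum_le_hasSum s (fun j _ => hf0 ε j) (hsumre ε hε)
  have hle : ∀ ε, 0 < ε → ∀ j, f ε j ≤ f 0 j := by
    intro ε hε j
    refine mul_le_mul_of_nonneg_right (mul_le_mul_of_nonneg_left ?_ (hD.nonneg j)) (h.nonneg _)
    refine Real.rpow_le_rpow_of_exponent_le ?_ (by linarith)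
    have : (0 : ℝ) ≤ j := Nat.cast_nonneg j
    linarith
  have ht : Tendsto (fun ε => ∑' j, (f ε j : ℂ)) (𝓝[>] 0) (𝓝 (∑' j, (f 0 j : ℂ))) := by
    refine tendsto_tsum_of_dominated_convergence hsum0
      (fun j => (continuous_ofReal.tendsto _).comp (hft j)) ?_
    filter_upwards [self_mem_nhdsWithin] with ε hε j
    rw [norm_real, Real.norm_of_nonneg (hf0 ε j)]
    exact hle ε hε j
  have heq : ∑' j, (f 0 j : ℂ) = R₀ := by
    refine tendsto_nhds_unique ht (hlim.congr' ?_)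
    filter_upwards [self_mem_nhdsWithin] with ε hε
    exact (hsum ε hε).tsum_eq.symm
  have hs0 : Summable fun j => (f 0 j : ℂ) := Complex.summable_ofReal.mpr hsum0
  have := hs0.hasSum
  rw [heq] at this
  simpa [hf] using this

lemma tendsto_moment_div (h : IsBandlimitedKernel M F ψ) {j : ℕ} (hj : j ≤ M) :
    Tendsto (fun U : ℝ => (∫ u in Set.Ioi (0 : ℝ), u ^ j * F (u - U)) / U ^ j) atTop
      (𝓝 (∫ w, F w)) := by
  have hc := h.continuous
  have h1 : ∀ U : ℝ, (∫ u in Set.Ioi (0 : ℝ), u ^ j * F (u - U)) / U ^ j =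
      ∫ w : ℝ, (Set.Ioi (0 : ℝ)).indicator (fun u => u ^ j * F (u - U)) (w + U) / U ^ j := by
    intro U
    rw [← integral_indicator measurableSet_Ioi, integral_div,
      integral_add_right_eq_self (fun w => (Set.Ioi (0 : ℝ)).indicator
        (fun u => u ^ j * F (u - U)) w)]
  simp only [h1]
  refine tendsto_integral_filter_of_dominated_convergence (fun w => (1 + |w|) ^ M * F w) ?_ ?_
    h.moment ?_
  · refine Eventually.of_forall fun U => Measurable.aestronglyMeasurable ?_
    refine Measurable.div_const ?_ _
    exact ((by fun_prop : Continuous fun u => u ^ j * F (u - U)).measurable.indicator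
      measurableSet_Ioi).comp (measurable_add_const U)
  · filter_upwards [eventually_ge_atTop 1] with U hU
    refine Eventually.of_forall fun w => ?_
    have hF := h.nonneg w
    have hU0 : 0 < U := by linarith
    by_cases hw : w + U ∈ Set.Ioi (0 : ℝ)
    · rw [Set.indicator_of_mem hw, add_sub_cancel_right, mul_div_right_comm, ← div_pow, norm_mul,
        norm_pow, Real.norm_of_nonneg hF, Real.norm_of_nonneg (div_nonneg (le_of_lt hw) hU0.le)]
      refine mul_le_mul_of_nonneg_right ?_ hF
      have h2 : (w + U) / U ≤ 1 + |w| := by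
        rw [div_le_iff₀ hU0]
        nlinarith [le_abs_self w, abs_nonneg w]
      exact (pow_le_pow_left₀ (div_nonneg (le_of_lt hw) hU0.le) h2 j).trans
        (pow_le_pow_right₀ (by linarith [abs_nonneg w]) hj)
    · rw [Set.indicator_of_notMem hw, zero_div, norm_zero]
      positivity
  · refine Eventually.of_forall fun w => ?_
    have h2 : Tendsto (fun U : ℝ => (w / U + 1) ^ j * F w) atTop (𝓝 ((0 + 1) ^ j * F w)) :=
      (((tendsto_id.const_div_atTop w).add_const 1).pow j).mul_const _
    rw [zero_add, one_pow, one_mul] at h2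
    refine h2.congr' ?_
    filter_upwards [eventually_gt_atTop 0, eventually_gt_atTop (-w)] with U hU hUw
    rw [Set.indicator_of_mem (by simp only [Set.mem_Ioi]; linarith), add_sub_cancel_right,
      show w / U + 1 = (w + U) / U by field_simp, div_pow]
    ring

lemma tendsto_remainder (ψ : ℝ → ℂ) (Φ : ℝ → ℂ) :
    Tendsto (fun U : ℝ => ∫ y : ℝ, cexp ((2 * Real.pi * y * U : ℝ) * I) * ψ y * Φ y)
      atTop (𝓝 0) := by
  have h1 := (Real.tendsto_integral_exp_smul_cocompact (fun y => ψ y * Φ y)).comp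
    (tendsto_neg_atTop_atBot.mono_right atBot_le_cocompact)
  refine h1.congr fun U => ?_
  refine integral_congr_ae (Eventually.of_forall fun y => ?_)
  simp only [Circle.smul_def, Real.fourierChar_apply, smul_eq_mul, mul_assoc, mul_neg, neg_neg]

lemma summable_boundary (h : IsBandlimitedKernel M F ψ) (hD : HasPolarPart a α M κ Φ) (U : ℝ) :
    Summable fun j : ℕ => a j * ((j : ℝ) + 1) ^ (-α) * F (Real.log (j + 1) - U) :=
  Complex.summable_ofReal.mp (h.hasSum_boundary hD U).summable

lemma tendsto_tsum_div (h : IsBandlimitedKernel M F ψ) (hD : HasPolarPart a α M κ Φ) {γ : ℝ}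
    (hγ : κ M = γ) :
    Tendsto (fun U : ℝ => (∑' j : ℕ, a j * ((j : ℝ) + 1) ^ (-α) * F (Real.log (j + 1) - U)) / U ^ M)
      atTop (𝓝 (γ / M.factorial * ∫ w, F w)) := by
  have hpow : ∀ j, j < M → Tendsto (fun U : ℝ => (U ^ (M - j))⁻¹) atTop (𝓝 0) := fun j hj =>
    (tendsto_pow_atTop (by omega)).inv_tendsto_atTop
  have hj : ∀ j ∈ Finset.range (M + 1), Tendsto (fun U : ℝ => κ j / j.factorial *
      (((∫ u in Set.Ioi (0 : ℝ), u ^ j * F (u - U)) / U ^ M : ℝ) : ℂ)) atTop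
      (𝓝 (κ j / j.factorial * ((if j = M then ∫ w, F w else 0 : ℝ) : ℂ))) := by
    intro j hj
    refine Tendsto.const_mul _ ((continuous_ofReal.tendsto _).comp ?_)
    have hjM : j ≤ M := Nat.lt_succ_iff.mp (Finset.mem_range.mp hj)
    rcases hjM.eq_or_lt with rfl | hlt
    · rw [if_pos rfl]
      exact h.tendsto_moment_div le_rfl
    · rw [if_neg hlt.ne]
      have h1 := (h.tendsto_moment_div hjM).mul (hpow j hlt)
      rw [mul_zero] at h1
      refine h1.congr fun U => ?_
      rw [← div_eq_mul_inv, div_div, ← pow_add, Nat.add_sub_cancel' hjM]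
  have hrem : Tendsto (fun U : ℝ => (∫ y : ℝ, cexp ((2 * Real.pi * y * U : ℝ) * I) * ψ y *
      Φ (α + (2 * Real.pi * y : ℝ) * I)) / ((U ^ M : ℝ) : ℂ)) atTop (𝓝 0) := by
    refine squeeze_zero_norm' ?_
      (tendsto_zero_iff_norm_tendsto_zero.mp (tendsto_remainder ψ fun y =>
        Φ (α + (2 * Real.pi * y : ℝ) * I)))
    filter_upwards [eventually_ge_atTop 1] with U hU
    rw [norm_div, norm_real, Real.norm_of_nonneg (by positivity)]
    exact div_le_self (norm_nonneg _) (one_le_pow₀ hU)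
  have hall := (tendsto_finsetSum _ hj).add hrem
  have h2 := (continuous_re.tendsto _).comp hall
  have hsum : (∑ j ∈ Finset.range (M + 1), κ j / j.factorial *
      ((if j = M then ∫ w, F w else 0 : ℝ) : ℂ) + 0).re = γ / M.factorial * ∫ w, F w := by
    rw [Finset.sum_eq_single M (fun j _ hjM => by rw [if_neg hjM]; simp) (by simp), if_pos rfl,
      hγ, add_zero]
    norm_cast
  rw [hsum] at h2
  refine h2.congr fun U => ?_
  have h3 := (h.hasSum_boundary hD U).tsum_eq
  rw [← ofReal_tsum] at h3
  have h4 : (((∑' j : ℕ, a j * ((j : ℝ) + 1) ^ (-α) * F (Real.log (j + 1) - U)) / U ^ M : ℝ) : ℂ) =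
      ∑ j ∈ Finset.range (M + 1), κ j / j.factorial *
      (((∫ u in Set.Ioi (0 : ℝ), u ^ j * F (u - U)) / U ^ M : ℝ) : ℂ) +
      (∫ y : ℝ, cexp ((2 * Real.pi * y * U : ℝ) * I) * ψ y *
      Φ (α + (2 * Real.pi * y : ℝ) * I)) / ((U ^ M : ℝ) : ℂ) := by
    rw [ofReal_div, h3, add_div, Finset.sum_div]
    congr 1
    refine Finset.sum_congr rfl fun j _ => ?_
    rw [ofReal_div, mul_div_assoc]
  simp only [Function.comp]
  rw [← h4, ofReal_re]

end IsBandlimitedKernel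

end BoundaryValue

section Unsmoothing

open Filter Topology MeasureTheory

lemma tendsto_setIntegral_closedBall {g : ℝ → ℝ} (hg : Integrable g) :
    Tendsto (fun N : ℕ => ∫ v in Metric.closedBall (0 : ℝ) N, g v) atTop (𝓝 (∫ v, g v)) :=
  (aecover_closedBall tendsto_natCast_atTop_atTop).integral_tendsto_of_countably_generated hg

lemma tendsto_setIntegral_compl_closedBall {g : ℝ → ℝ} (hg : Integrable g) :
    Tendsto (fun N : ℕ => ∫ v in (Metric.closedBall (0 : ℝ) N)ᶜ, g v) atTop (𝓝 0) := by
  have h1 := (tendsto_setIntegral_closedBall hg).const_sub (∫ v, g v)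
  rw [sub_self] at h1
  refine h1.congr fun N => ?_
  rw [← integral_add_compl measurableSet_closedBall hg, add_sub_cancel_left]

variable {Q F : ℝ → ℝ} {β Λ : ℝ} {M : ℕ}

lemma abs_div_sq_le {N : ℕ} (hN : 0 < N) {v : ℝ} (hv : v ∈ Metric.closedBall (0 : ℝ) N) :
    |v / (N : ℝ) ^ 2| ≤ 1 / N := by
  have hN' : (0 : ℝ) < N := by exact_mod_cast hN
  rw [mem_closedBall_zero_iff, Real.norm_eq_abs] at hv
  rw [abs_div, abs_of_nonneg (by positivity : (0 : ℝ) ≤ (N : ℝ) ^ 2),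
    div_le_div_iff₀ (by positivity) hN']
  nlinarith

lemma le_smoothed (hβ : 0 ≤ β) (hQ : ∀ U, 0 ≤ Q U)
    (hmono : ∀ U h, 0 ≤ h → Real.exp (-(β * h)) * Q U ≤ Q (U + h))
    (hF : ∀ v, 0 ≤ F v) (hFi : Integrable F) {N : ℕ} (hN : 0 < N) (U : ℝ)
    (hi : Integrable fun v => F v * Q (U + 1 / N + v / (N : ℝ) ^ 2)) :
    Real.exp (-(β * (2 / N))) * Q U * ∫ v in Metric.closedBall (0 : ℝ) N, F v ≤
      ∫ v, F v * Q (U + 1 / N + v / (N : ℝ) ^ 2) := by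
  rw [← integral_const_mul]
  refine le_trans ?_ (setIntegral_le_integral
    (s := Metric.closedBall (0 : ℝ) N) hi
    (Eventually.of_forall fun v => mul_nonneg (hF v) (hQ _)))
  refine setIntegral_mono_on (hFi.const_mul _).integrableOn hi.integrableOn
    measurableSet_closedBall fun v hv => ?_
  have h1 := abs_le.mp (abs_div_sq_le hN hv)
  have h2 := hmono U (1 / N + v / (N : ℝ) ^ 2) (by linarith [h1.1])
  rw [mul_comm, add_assoc]
  refine mul_le_mul_of_nonneg_left (le_trans ?_ h2) (hF v)
  refine mul_le_mul_of_nonneg_right (Real.exp_le_exp.mpr ?_) (hQ U)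
  refine neg_le_neg (mul_le_mul_of_nonneg_left ?_ hβ)
  have : (2 : ℝ) / N = 1 / N + 1 / N := by ring
  linarith [h1.2]

lemma smoothed_le (hβ : 0 ≤ β) (hQ : ∀ U, 0 ≤ Q U)
    (hmono : ∀ U h, 0 ≤ h → Real.exp (-(β * h)) * Q U ≤ Q (U + h))
    (hF : ∀ v, 0 ≤ F v) (hFi : Integrable F) (hF1 : ∫ v, F v = 1)
    (hFM : Integrable fun v => (1 + |v|) ^ M * F v) {C : ℝ} (hC : 0 ≤ C)
    (hQC : ∀ U, Q U ≤ C * (1 + |U|) ^ M) {N : ℕ} (hN : 0 < N) {U : ℝ} (hU : 1 ≤ U)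
    (hi : Integrable fun v => F v * Q (U - 1 / N + v / (N : ℝ) ^ 2)) :
    ∫ v, F v * Q (U - 1 / N + v / (N : ℝ) ^ 2) ≤ Real.exp (β * (2 / N)) * Q U +
      C * (2 * U) ^ M * ∫ v in (Metric.closedBall (0 : ℝ) N)ᶜ, (1 + |v|) ^ M * F v := by
  rw [← integral_add_compl (measurableSet_closedBall (x := (0 : ℝ)) (ε := (N : ℝ))) hi]
  have hN1 : (1 : ℝ) ≤ N := by exact_mod_cast hN
  have h1N : (1 : ℝ) / N ≤ 1 := by rw [div_le_one (by linarith)]; exact hN1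
  have h0N : (0 : ℝ) ≤ 1 / N := by positivity
  refine add_le_add ?_ ?_
  · calc ∫ v in Metric.closedBall (0 : ℝ) N, F v * Q (U - 1 / N + v / (N : ℝ) ^ 2)
        ≤ ∫ v in Metric.closedBall (0 : ℝ) N, Real.exp (β * (2 / N)) * Q U * F v := by
          refine setIntegral_mono_on hi.integrableOn (hFi.const_mul _).integrableOn
            measurableSet_closedBall fun v hv => ?_
          have h1 := abs_le.mp (abs_div_sq_le hN hv)
          have h2 := hmono (U - 1 / N + v / (N : ℝ) ^ 2) (1 / N - v / (N : ℝ) ^ 2)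
            (by linarith [h1.2])
          rw [show U - 1 / N + v / (N : ℝ) ^ 2 + (1 / N - v / (N : ℝ) ^ 2) = U by ring,
            Real.exp_neg, inv_mul_le_iff₀ (Real.exp_pos _)] at h2
          rw [mul_comm (F v)]
          refine mul_le_mul_of_nonneg_right (h2.trans ?_) (hF v)
          refine mul_le_mul_of_nonneg_right (Real.exp_le_exp.mpr ?_) (hQ U)
          refine mul_le_mul_of_nonneg_left ?_ hβ
          have : (2 : ℝ) / N = 1 / N + 1 / N := by ring
          linarith [h1.1]
      _ ≤ ∫ v, Real.exp (β * (2 / N)) * Q U * F v :=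
          setIntegral_le_integral (hFi.const_mul _) (Eventually.of_forall fun v =>
            mul_nonneg (mul_nonneg (Real.exp_pos _).le (hQ U)) (hF v))
      _ = Real.exp (β * (2 / N)) * Q U := by rw [integral_const_mul, hF1, mul_one]
  · rw [← integral_const_mul]
    refine setIntegral_mono_on hi.integrableOn (hFM.const_mul _).integrableOn
      measurableSet_closedBall.compl fun v _ => ?_
    rw [mul_comm (F v), ← mul_assoc]
    refine mul_le_mul_of_nonneg_right ((hQC _).trans ?_) (hF v)
    rw [mul_assoc]
    refine mul_le_mul_of_nonneg_left ?_ hC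
    refine (one_add_abs_add_pow_le M _ _).trans ?_
    have h2 : |v / (N : ℝ) ^ 2| ≤ |v| := by
      rw [abs_div, abs_of_nonneg (by positivity : (0 : ℝ) ≤ (N : ℝ) ^ 2)]
      exact div_le_self (abs_nonneg v) (one_le_pow₀ hN1)
    have h3 : 1 + |U - 1 / N| ≤ 2 * U := by
      rw [abs_of_nonneg (by linarith)]
      linarith
    gcongr

lemma tendsto_shift_div_pow {S : ℝ → ℝ} (hS : Tendsto (fun U => S U / U ^ M) atTop (𝓝 Λ))
    (η : ℝ) : Tendsto (fun U => S (U + η) / U ^ M) atTop (𝓝 Λ) := by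
  have h1 := hS.comp (tendsto_atTop_add_const_right atTop η tendsto_id)
  have h2 : Tendsto (fun U : ℝ => (1 + η / U) ^ M) atTop (𝓝 ((1 + 0) ^ M)) :=
    ((tendsto_id.const_div_atTop η).const_add 1).pow M
  have h3 := h1.mul h2
  rw [add_zero, one_pow, mul_one] at h3
  refine h3.congr' ?_
  filter_upwards [eventually_gt_atTop 0, eventually_gt_atTop (-η)] with U hU hη
  have : U + η ≠ 0 := by linarith
  simp only [Function.comp, id]
  rw [show 1 + η / U = (U + η) / U by field_simp, div_pow]
  field_simp

lemma exists_le_mul_one_add_abs_pow (hβ : 0 ≤ β) (hQ : ∀ U, 0 ≤ Q U)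
    (hmono : ∀ U h, 0 ≤ h → Real.exp (-(β * h)) * Q U ≤ Q (U + h))
    (hbdd : ∃ C, ∀ U ≤ 0, Q U ≤ C) {C : ℝ} (hC : ∀ᶠ U in atTop, Q U ≤ C * U ^ M) :
    ∃ C', 0 ≤ C' ∧ ∀ U, Q U ≤ C' * (1 + |U|) ^ M := by
  obtain ⟨B, hB⟩ := hbdd
  obtain ⟨U₀, hU₀⟩ := eventually_atTop.mp hC
  set U₁ := max U₀ 0
  have hE : 0 ≤ Real.exp (β * U₁) * Q U₁ := mul_nonneg (Real.exp_pos _).le (hQ _)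
  refine ⟨|B| + |C| + Real.exp (β * U₁) * Q U₁, by positivity, fun U => ?_⟩
  have hp : (1 : ℝ) ≤ (1 + |U|) ^ M := one_le_pow₀ (by linarith [abs_nonneg U])
  have hp0 : (0 : ℝ) ≤ (1 + |U|) ^ M := by positivity
  rcases le_total U 0 with h0 | h0
  · have := (hB U h0).trans (le_abs_self B)
    nlinarith [abs_nonneg B, abs_nonneg C]
  rcases le_total U U₁ with h1 | h1
  · have h2 := hmono U (U₁ - U) (by linarith)
    rw [add_sub_cancel, Real.exp_neg, inv_mul_le_iff₀ (Real.exp_pos _)] at h2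
    have h3 : Real.exp (β * (U₁ - U)) ≤ Real.exp (β * U₁) :=
      Real.exp_le_exp.mpr (mul_le_mul_of_nonneg_left (by linarith) hβ)
    have h4 := h2.trans (mul_le_mul_of_nonneg_right h3 (hQ U₁))
    nlinarith [abs_nonneg B, abs_nonneg C]
  · have h2 := hU₀ U ((le_max_left _ _).trans h1)
    have h3 : U ^ M ≤ (1 + |U|) ^ M := by
      rw [abs_of_nonneg h0]
      exact pow_le_pow_left₀ h0 (by linarith) M
    have h4 : C * U ^ M ≤ |C| * (1 + |U|) ^ M :=
      mul_le_mul (le_abs_self C) h3 (by positivity) (abs_nonneg C)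
    have h5 : 0 ≤ (|B| + Real.exp (β * U₁) * Q U₁) * (1 + |U|) ^ M := by positivity
    linarith

/-- If the averages of `Q` against all the rescalings of `F` grow like `Λ * U ^ M`, and if
`exp (β * U) * Q U` is increasing, then `Q U` itself grows like `Λ * U ^ M`. -/
lemma tendsto_div_pow_of_smoothed (hβ : 0 ≤ β) (hQ : ∀ U, 0 ≤ Q U)
    (hmono : ∀ U h, 0 ≤ h → Real.exp (-(β * h)) * Q U ≤ Q (U + h))
    (hbdd : ∃ C, ∀ U ≤ 0, Q U ≤ C)
    (hF : ∀ v, 0 ≤ F v) (hFi : Integrable F) (hF1 : ∫ v, F v = 1)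
    (hFM : Integrable fun v => (1 + |v|) ^ M * F v)
    (hi : ∀ l : ℝ, 0 < l → ∀ U, Integrable fun v => F v * Q (U + v / l))
    (hlim : ∀ l : ℝ, 0 < l → Tendsto (fun U => (∫ v, F v * Q (U + v / l)) / U ^ M) atTop (𝓝 Λ)) :
    Tendsto (fun U => Q U / U ^ M) atTop (𝓝 Λ) := by
  have hsq : ∀ N : ℕ, 0 < N → (0 : ℝ) < (N : ℝ) ^ 2 := fun N hN => by positivity
  have hI := tendsto_setIntegral_closedBall hFi
  rw [hF1] at hI
  have hT := tendsto_setIntegral_compl_closedBall hFM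
  have hexp : ∀ s : ℝ, Tendsto (fun N : ℕ => Real.exp (s * (2 / N))) atTop (𝓝 1) := by
    intro s
    have h1 := (tendsto_natCast_atTop_atTop (R := ℝ)).const_div_atTop 2
    have h2 := (Real.continuous_exp.tendsto _).comp (h1.const_mul s)
    simpa [Function.comp_def] using h2
  have hupper : ∀ N : ℕ, 0 < N → 0 < ∫ v in Metric.closedBall (0 : ℝ) N, F v → ∀ U > 0,
      Q U / U ^ M ≤ Real.exp (β * (2 / N)) / (∫ v in Metric.closedBall (0 : ℝ) N, F v) *
        ((∫ v, F v * Q (U + 1 / N + v / (N : ℝ) ^ 2)) / U ^ M) := by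
    intro N hN hpos U hU
    have h1 := le_smoothed hβ hQ hmono hF hFi hN U (hi _ (hsq N hN) _)
    rw [← mul_div_assoc]
    refine div_le_div_of_nonneg_right ?_ (by positivity)
    rw [div_mul_eq_mul_div, le_div_iff₀ hpos]
    rw [Real.exp_neg, mul_assoc, inv_mul_le_iff₀ (Real.exp_pos _)] at h1
    exact h1
  have hupper_lim : ∀ N : ℕ, 0 < N → Tendsto (fun U => Real.exp (β * (2 / N)) /
      (∫ v in Metric.closedBall (0 : ℝ) N, F v) *
        ((∫ v, F v * Q (U + 1 / N + v / (N : ℝ) ^ 2)) / U ^ M)) atTop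
      (𝓝 (Real.exp (β * (2 / N)) / (∫ v in Metric.closedBall (0 : ℝ) N, F v) * Λ)) :=
    fun N hN => (tendsto_shift_div_pow (hlim _ (hsq N hN)) (1 / N)).const_mul _
  have hup : Tendsto (fun N : ℕ => Real.exp (β * (2 / N)) /
      (∫ v in Metric.closedBall (0 : ℝ) N, F v) * Λ) atTop (𝓝 Λ) := by
    simpa using (((hexp β).div hI one_ne_zero).mul_const Λ)
  have hgood : ∀ᶠ N : ℕ in atTop, 0 < N ∧ 0 < ∫ v in Metric.closedBall (0 : ℝ) N, F v :=
    (eventually_gt_atTop 0).and (hI.eventually_const_lt one_pos)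
  have hbound : ∀ b, Λ < b → ∀ᶠ U in atTop, Q U / U ^ M < b := by
    intro b hb
    obtain ⟨N, hNb, hN, hpos⟩ := ((hup.eventually_lt_const hb).and hgood).exists
    filter_upwards [(hupper_lim N hN).eventually_lt_const hNb, eventually_gt_atTop 0] with U h1 h2
    exact (hupper N hN hpos U h2).trans_lt h1
  obtain ⟨C, hC0, hC⟩ := exists_le_mul_one_add_abs_pow hβ hQ hmono hbdd (M := M) (C := Λ + 1) (by
    filter_upwards [hbound (Λ + 1) (lt_add_one Λ), eventually_gt_atTop 0] with U h1 h2
    rw [div_lt_iff₀ (by positivity)] at h1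
    exact h1.le)
  refine tendsto_order.mpr ⟨fun b hb => ?_, hbound⟩
  have hlow : Tendsto (fun N : ℕ => Real.exp (-β * (2 / N)) * (Λ - C * 2 ^ M *
      ∫ v in (Metric.closedBall (0 : ℝ) N)ᶜ, (1 + |v|) ^ M * F v)) atTop (𝓝 Λ) := by
    simpa using (hexp (-β)).mul ((hT.const_mul (C * 2 ^ M)).const_sub Λ)
  obtain ⟨N, hNb, hN⟩ := ((hlow.eventually_const_lt hb).and (eventually_gt_atTop 0)).exists
  have hlow_lim := ((tendsto_shift_div_pow (hlim _ (hsq N hN)) (-(1 / N))).sub_const (C * 2 ^ M *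
      ∫ v in (Metric.closedBall (0 : ℝ) N)ᶜ, (1 + |v|) ^ M * F v)).const_mul
      (Real.exp (-β * (2 / N)))
  filter_upwards [hlow_lim.eventually_const_lt hNb, eventually_ge_atTop 1] with U h1 h2
  refine h1.trans_le ?_
  have h3 := smoothed_le hβ hQ hmono hF hFi hF1 hFM hC0 hC hN h2 (hi _ (hsq N hN) _)
  have hU : 0 < U ^ M := by positivity
  rw [neg_mul, Real.exp_neg, inv_mul_le_iff₀ (Real.exp_pos _), sub_le_iff_le_add, div_le_iff₀ hU,
    ← sub_eq_add_neg]
  refine h3.trans (le_of_eq ?_)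
  rw [mul_pow]
  field_simp

end Unsmoothing

section BandlimitedConstruction

open Filter Topology MeasureTheory Complex

open scoped FourierTransform Convolution ContDiff

lemma fourier_ofReal_of_even {φ : ℝ → ℝ} (hφ : ∀ y, φ (-y) = φ y) (v : ℝ) :
    𝓕 (fun y => (φ y : ℂ)) v * 𝓕 (fun y => (φ y : ℂ)) v =
      ((‖𝓕 (fun y => (φ y : ℂ)) v‖ ^ 2 : ℝ) : ℂ) := by
  have h1 : (starRingEnd ℂ) (𝓕 (fun y => (φ y : ℂ)) v) = 𝓕 (fun y => (φ y : ℂ)) v := by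
    simp only [Real.fourier_real_eq_integral_exp_smul, smul_eq_mul]
    rw [← integral_conj, ← integral_neg_eq_self]
    refine integral_congr_ae (Eventually.of_forall fun y => ?_)
    simp only [map_mul, conj_ofReal, ← exp_conj, conj_I, hφ]
    congr 2
    push_cast
    ring
  have h2 := mul_conj (𝓕 (fun y => (φ y : ℂ)) v)
  rw [h1] at h2
  rw [h2, normSq_eq_norm_sq]

lemma exists_isBandlimitedKernel (M : ℕ) :
    ∃ (F : ℝ → ℝ) (ψ : ℝ → ℂ), IsBandlimitedKernel M F ψ ∧ ∫ v, F v = 1 := by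
  let φ : ContDiffBump (0 : ℝ) := ⟨1, 2, one_pos, one_lt_two⟩
  set f : ℝ → ℂ := fun y => (φ y : ℂ) with hf
  have hfs : HasCompactSupport f := φ.hasCompactSupport.comp_left ofReal_zero
  have hfc : ContDiff ℝ ∞ f := ofRealCLM.contDiff.comp φ.contDiff
  set S := hfs.toSchwartzMap hfc
  set g := 𝓕 S
  have hg : ∀ v, g v = 𝓕 f v := fun v => by rw [SchwartzMap.fourier_coe]; rfl
  have hfi : Integrable f := hfc.continuous.integrable_of_hasCompactSupport hfs
  set F : ℝ → ℝ := fun v => ‖𝓕 f v‖ ^ 2 with hF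
  have hFg : F = fun v => ‖g v‖ ^ 2 := funext fun v => by rw [hF, hg]
  set ψ : ℝ → ℂ := f ⋆[ContinuousLinearMap.mul ℂ ℂ, volume] f with hψ
  have hψc : Continuous ψ :=
    hfs.continuous_convolution_left _ hfc.continuous hfc.continuous.locallyIntegrable
  have hψs : HasCompactSupport ψ := hfs.convolution _ hfs
  have hFcont : Continuous F := by
    rw [hFg]
    exact (g.continuous.norm).pow 2
  have hmom : ∀ k : ℕ, Integrable fun v => (1 + |v|) ^ k * F v := by
    intro k
    set C := 2 ^ k * (Finset.Iic (k, 0)).sup (fun m => SchwartzMap.seminorm ℝ m.1 m.2) g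
    have hC : ∀ v, (1 + |v|) ^ k * ‖g v‖ ≤ C := fun v => by
      simpa using SchwartzMap.one_add_le_sup_seminorm_apply (𝕜 := ℝ) (m := (k, 0)) (k := k)
        (n := 0) le_rfl le_rfl g v
    refine (g.integrable.norm.const_mul C).mono
      (by fun_prop : Continuous fun v => (1 + |v|) ^ k * F v).aestronglyMeasurable
      (Eventually.of_forall fun v => ?_)
    have h1 := hC v
    have h2 : 0 ≤ (1 + |v|) ^ k * ‖g v‖ := by positivity
    simp only [hFg]
    rw [Real.norm_of_nonneg (by positivity),
      Real.norm_of_nonneg (mul_nonneg (h2.trans h1) (norm_nonneg _)), pow_two, ← mul_assoc]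
    exact mul_le_mul_of_nonneg_right h1 (norm_nonneg _)
  have hFi : Integrable F := by simpa using hmom 0
  have hF0 : F 0 ≠ 0 := by
    have h1 : 𝓕 f 0 = ((∫ y, φ y : ℝ) : ℂ) := by
      rw [Real.fourier_real_eq_integral_exp_smul, ← integral_complex_ofReal]
      simp [hf]
    have h2 : 0 < ∫ y, φ y := φ.integral_pos
    simp only [hF, h1]
    rw [norm_real, Real.norm_of_nonneg h2.le]
    positivity
  have hpos : 0 < ∫ v, F v := by
    rw [integral_pos_iff_support_of_nonneg (fun v => by positivity) hFi]
    exact hFcont.isOpen_support.measure_pos volume ⟨0, hF0⟩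
  refine ⟨fun v => (∫ v, F v)⁻¹ * F v, fun y => ((∫ v, F v)⁻¹ : ℝ) * ψ y, ⟨fun v => ?_,
    ?_, ?_, fun v => ?_, ?_⟩, ?_⟩
  · exact mul_nonneg (inv_nonneg.mpr hpos.le) (sq_nonneg _)
  · exact continuous_const.mul hψc
  · exact hψs.mul_left
  · have h1 := Real.fourier_mul_convolution_eq hfi hfi v
    rw [fourier_ofReal_of_even (fun y => φ.neg y), Real.fourier_real_eq_integral_exp_smul] at h1
    rw [ofReal_mul, ← h1, ← integral_const_mul]
    refine integral_congr_ae (Eventually.of_forall fun y => ?_)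
    simp only [smul_eq_mul]
    ring
  · refine ((hmom M).const_mul (∫ v, F v)⁻¹).congr (Eventually.of_forall fun v => ?_)
    simp only
    ring
  · rw [integral_const_mul, inv_mul_cancel₀ hpos.ne']

namespace IsBandlimitedKernel

variable {M : ℕ} {F : ℝ → ℝ} {ψ : ℝ → ℂ}

lemma integrable (h : IsBandlimitedKernel M F ψ) : Integrable F := by
  simpa using h.integrable_pow_mul (Nat.zero_le M) 0

lemma scale (h : IsBandlimitedKernel M F ψ) {l : ℝ} (hl : 0 < l) :
    IsBandlimitedKernel M (fun w => l * F (l * w)) fun y => ψ (y / l) where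
  nonneg w := mul_nonneg hl.le (h.nonneg _)
  continuous_symbol := h.continuous_symbol.comp (continuous_id.div_const l)
  compact := by
    have := h.compact.comp_homeomorph (Homeomorph.mulRight₀ l⁻¹ (inv_ne_zero hl.ne'))
    simpa [Function.comp_def, div_eq_mul_inv] using this
  eq w := by
    have h1 := Measure.integral_comp_div (fun y : ℝ =>
      cexp (((-2 * Real.pi * y * (l * w) : ℝ) : ℂ) * I) * ψ y) l
    rw [← h.eq, abs_of_pos hl] at h1
    rw [ofReal_mul, ← real_smul, ← h1]
    refine integral_congr_ae (Eventually.of_forall fun y => ?_)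
    simp only
    congr 4
    field_simp
  moment := by
    have hc := h.continuous
    have h1 : Integrable fun w => (1 + |l * w|) ^ M * F (l * w) :=
      h.moment.comp_mul_left' hl.ne'
    refine (h1.const_mul ((1 + l⁻¹) ^ M * l)).mono
      (by fun_prop : Continuous fun w => (1 + |w|) ^ M * (l * F (l * w))).aestronglyMeasurable
      (Eventually.of_forall fun w => ?_)
    have hF := h.nonneg (l * w)
    have h2 : 1 + |w| ≤ (1 + l⁻¹) * (1 + |l * w|) := by
      rw [abs_mul, abs_of_pos hl]
      have h3 : l⁻¹ * (l * |w|) = |w| := by field_simp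
      have h4 : 0 ≤ l⁻¹ + l * |w| := by positivity
      nlinarith
    rw [Real.norm_of_nonneg (by positivity), Real.norm_of_nonneg (by positivity)]
    calc (1 + |w|) ^ M * (l * F (l * w))
        ≤ ((1 + l⁻¹) * (1 + |l * w|)) ^ M * (l * F (l * w)) := by gcongr
      _ = (1 + l⁻¹) ^ M * l * ((1 + |l * w|) ^ M * F (l * w)) := by
        rw [mul_pow]
        ring

lemma convolution (h : IsBandlimitedKernel M F ψ) {k : ℝ → ℝ} (hk : ∀ w, 0 ≤ k w)
    (hki : Integrable k) (hkM : Integrable fun w => (1 + |w|) ^ M * k w) :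
    IsBandlimitedKernel M (fun x => ∫ w, F w * k (x - w))
      fun y => ψ y * ∫ w : ℝ, cexp (((2 * Real.pi * y * w : ℝ) : ℂ) * I) * k w where
  nonneg x := integral_nonneg fun w => mul_nonneg (h.nonneg w) (hk _)
  continuous_symbol := by
    refine h.continuous_symbol.mul ?_
    refine continuous_of_dominated (bound := fun w => ‖(k w : ℂ)‖) (fun y => ?_) (fun y => ?_)
      hki.ofReal.norm ?_
    · exact (Continuous.aestronglyMeasurable (by fun_prop)).mul hki.ofReal.aestronglyMeasurable
    · exact Eventually.of_forall fun w => (norm_exp_mul_I_mul _ _).le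
    · exact Eventually.of_forall fun w => by fun_prop
  compact := h.compact.mul_right
  eq x := by
    have h1 : ((∫ w, F w * k (x - w) : ℝ) : ℂ) = ∫ w : ℝ, ∫ y : ℝ,
        cexp (((-2 * Real.pi * y * (x - w) : ℝ) : ℂ) * I) * (k w * ψ y) := by
      rw [← integral_sub_left_eq_self _ volume x, ← integral_complex_ofReal]
      refine integral_congr_ae (Eventually.of_forall fun w => ?_)
      simp only [sub_sub_cancel]
      rw [ofReal_mul, h.eq, ← integral_mul_const]
      refine integral_congr_ae (Eventually.of_forall fun y => ?_)
      simp only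
      ring
    rw [h1, integral_integral_swap]
    · refine integral_congr_ae (Eventually.of_forall fun y => ?_)
      simp only
      rw [← integral_const_mul, ← integral_const_mul]
      refine integral_congr_ae (Eventually.of_forall fun w => ?_)
      simp only
      rw [show cexp (((-2 * Real.pi * y * (x - w) : ℝ) : ℂ) * I) =
        cexp (((-2 * Real.pi * y * x : ℝ) : ℂ) * I) *
          cexp (((2 * Real.pi * y * w : ℝ) : ℂ) * I) by
        rw [← Complex.exp_add]
        congr 1
        push_cast
        ring]
      ring
    · have h2 := hki.ofReal.mul_prod h.integrable_symbol
      refine h2.mono ?_ (Eventually.of_forall fun p => (norm_exp_mul_I_mul _ _).le)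
      exact (Continuous.aestronglyMeasurable (by fun_prop)).mul h2.aestronglyMeasurable
  moment := by
    have h1 := h.moment.convolution_integrand (ContinuousLinearMap.mul ℝ ℝ) hkM
    have h2 := h.integrable.convolution_integrand (ContinuousLinearMap.mul ℝ ℝ) hki
    have h3 : Integrable (fun p : ℝ × ℝ => (1 + |p.1|) ^ M * (F p.2 * k (p.1 - p.2)))
        (volume.prod volume) := by
      refine h1.mono ((Continuous.aestronglyMeasurable (by fun_prop)).mul h2.aestronglyMeasurable)
        (Eventually.of_forall fun p => ?_)
      have h4 := one_add_abs_add_pow_le M p.2 (p.1 - p.2)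
      have h5 := h.nonneg p.2
      have h6 := hk (p.1 - p.2)
      rw [add_sub_cancel] at h4
      rw [ContinuousLinearMap.mul_apply', Real.norm_of_nonneg (by positivity),
        Real.norm_of_nonneg (by positivity)]
      calc (1 + |p.1|) ^ M * (F p.2 * k (p.1 - p.2))
          ≤ ((1 + |p.2|) ^ M * (1 + |p.1 - p.2|) ^ M) * (F p.2 * k (p.1 - p.2)) := by gcongr
        _ = _ := by ring
    have h4 := h3.integral_prod_left
    simpa only [integral_const_mul] using h4

lemma integral_convolution (h : IsBandlimitedKernel M F ψ) {k : ℝ → ℝ} (hki : Integrable k) :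
    ∫ x, ∫ w, F w * k (x - w) = (∫ w, F w) * ∫ w, k w :=
  MeasureTheory.integral_convolution (ContinuousLinearMap.mul ℝ ℝ) h.integrable hki

end IsBandlimitedKernel

end BandlimitedConstruction

section GammaKernel

open Filter Topology MeasureTheory

/-- The density of the logarithm of a Gamma variable, up to normalization. -/
noncomputable def gammaKernel (β v : ℝ) : ℝ := Real.exp (β * v) * Real.exp (-Real.exp v)

lemma gammaKernel_nonneg (β v : ℝ) : 0 ≤ gammaKernel β v := by
  unfold gammaKernel
  positivity

@[fun_prop]
lemma continuous_gammaKernel (β : ℝ) : Continuous (gammaKernel β) := by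
  unfold gammaKernel
  fun_prop

lemma abs_exp_smul_eq_gammaKernel (β v : ℝ) :
    |Real.exp v| • (Real.exp (-Real.exp v) * Real.exp v ^ (β - 1)) = gammaKernel β v := by
  rw [Real.abs_exp, smul_eq_mul, gammaKernel, ← Real.exp_mul, mul_left_comm, ← Real.exp_add,
    mul_comm]
  congr 2
  ring

lemma integrable_gammaKernel {β : ℝ} (hβ : 0 < β) : Integrable (gammaKernel β) := by
  have h1 := Real.GammaIntegral_convergent hβ
  rw [← Real.range_exp, ← Set.image_univ, integrableOn_image_iff_integrableOn_abs_deriv_smul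
    MeasurableSet.univ (fun x _ => (Real.hasDerivAt_exp x).hasDerivWithinAt)
    Real.exp_injective.injOn] at h1
  simpa only [abs_exp_smul_eq_gammaKernel, integrableOn_univ] using h1

lemma integral_gammaKernel {β : ℝ} (hβ : 0 < β) : ∫ v, gammaKernel β v = Real.Gamma β := by
  rw [Real.Gamma_eq_integral hβ, ← Real.range_exp, ← Set.image_univ,
    integral_image_eq_integral_abs_deriv_smul
    MeasurableSet.univ (fun x _ => (Real.hasDerivAt_exp x).hasDerivWithinAt)
    Real.exp_injective.injOn]
  simp only [abs_exp_smul_eq_gammaKernel, setIntegral_univ]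

lemma exp_mul_gammaKernel (δ β v : ℝ) :
    Real.exp (δ * v) * gammaKernel β v = gammaKernel (β + δ) v := by
  rw [gammaKernel, gammaKernel, ← mul_assoc, ← Real.exp_add]
  congr 2
  ring

lemma integrable_pow_mul_gammaKernel {β : ℝ} (hβ : 0 < β) (M : ℕ) :
    Integrable fun v => (1 + |v|) ^ M * gammaKernel β v := by
  have hδ : 0 < β / 2 := by positivity
  set C := M.factorial / (β / 2) ^ M * Real.exp (β / 2)
  have h1 : ∀ v : ℝ, (1 + |v|) ^ M ≤ C * (Real.exp (β / 2 * v) + Real.exp (-(β / 2) * v)) := by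
    intro v
    have h2 := Real.pow_div_factorial_le_exp (β / 2 * (1 + |v|)) (by positivity) M
    rw [mul_pow, div_le_iff₀ (by positivity)] at h2
    have h3 : Real.exp (β / 2 * (1 + |v|)) ≤
        Real.exp (β / 2) * (Real.exp (β / 2 * v) + Real.exp (-(β / 2) * v)) := by
      rw [mul_add, mul_one, Real.exp_add]
      refine mul_le_mul_of_nonneg_left ?_ (Real.exp_pos _).le
      rcases abs_cases v with ⟨hv, _⟩ | ⟨hv, _⟩
      · rw [hv]
        linarith [Real.exp_pos (-(β / 2) * v)]
      · rw [hv, mul_neg, ← neg_mul]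
        linarith [Real.exp_pos (β / 2 * v)]
    have h4 := h2.trans (mul_le_mul_of_nonneg_right h3 (Nat.cast_nonneg _))
    rw [mul_comm] at h4
    rw [← le_div_iff₀ (by positivity)] at h4
    refine h4.trans (le_of_eq ?_)
    simp only [C]
    ring
  have h2 := ((integrable_gammaKernel (show 0 < β + β / 2 by positivity)).add
    (integrable_gammaKernel (show 0 < β + -(β / 2) by linarith))).const_mul C
  refine h2.mono (by fun_prop : Continuous fun v =>
    (1 + |v|) ^ M * gammaKernel β v).aestronglyMeasurable (Eventually.of_forall fun v => ?_)
  have h3 := gammaKernel_nonneg β v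
  have h4 := mul_le_mul_of_nonneg_right (h1 v) h3
  rw [Real.norm_of_nonneg (by positivity), Pi.add_apply, ← exp_mul_gammaKernel,
    ← exp_mul_gammaKernel]
  refine (h4.trans (le_of_eq ?_)).trans (le_abs_self _)
  ring

lemma gammaKernel_log_sub (β U : ℝ) {y : ℝ} (hy : 0 < y) :
    gammaKernel β (Real.log y - U) =
      y ^ β * (Real.exp (-(β * U)) * Real.exp (-(y * Real.exp (-U)))) := by
  rw [gammaKernel, sub_eq_add_neg, Real.exp_add, Real.exp_log hy, mul_add, Real.exp_add, mul_neg,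
    Real.rpow_def_of_pos hy, mul_comm β (Real.log y)]
  ring

lemma integrable_tsum_of_nonneg {f : ℕ → ℝ → ℝ} (hf : ∀ j v, 0 ≤ f j v)
    (hi : ∀ j, Integrable (f j)) (hs : ∀ v, Summable fun j => f j v)
    (hS : Summable fun j => ∫ v, f j v) : Integrable fun v => ∑' j, f j v := by
  refine ⟨aestronglyMeasurable_of_tendsto_ae atTop
    (f := fun n v => ∑ j ∈ Finset.range n, f j v) (fun n => ?_)
    (Eventually.of_forall fun v => (hs v).tendsto_sum_tsum_nat), ?_⟩
  · exact (integrable_finsetSum _ fun j _ => hi j).aestronglyMeasurable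
  · rw [hasFiniteIntegral_iff_ofReal (Eventually.of_forall fun v => tsum_nonneg fun j => hf j v)]
    simp only [ENNReal.ofReal_tsum_of_nonneg (fun j => hf j _) (hs _)]
    rw [lintegral_tsum fun j => (hi j).aestronglyMeasurable.aemeasurable.ennreal_ofReal]
    simp only [← ofReal_integral_eq_lintegral_ofReal (hi _) (Eventually.of_forall (hf _))]
    exact hS.tsum_ofReal_ne_top.lt_top

end GammaKernel

section LaplaceAsymptotics

open Filter Topology MeasureTheory

lemma IsBandlimitedKernel.norm_le {M : ℕ} {F : ℝ → ℝ} {ψ : ℝ → ℂ} (h : IsBandlimitedKernel M F ψ)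
    (v : ℝ) : ‖F v‖ ≤ ∫ y, ‖ψ y‖ := by
  rw [← Complex.norm_real, h.eq]
  refine (norm_integral_le_integral_norm _).trans (le_of_eq ?_)
  simp only [norm_exp_mul_I_mul]

namespace HasPolarPart

variable {a : ℕ → ℝ} {α : ℝ} {M : ℕ} {κ : ℕ → ℂ} {Φ : ℂ → ℂ}

lemma summable_laplace (h : HasPolarPart a α M κ Φ) {t : ℝ} (ht : 0 < t) :
    Summable fun j : ℕ => a j / ((j : ℝ) + 1) * Real.exp (-((j + 1) * t)) := by
  have h1 := h.summable (α + 1 : ℝ) (by rw [Complex.ofReal_re]; linarith)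
  have h2 := (tendsto_rpow_mul_exp_neg_mul_atTop_nhds_zero α t ht).comp
    (tendsto_atTop_add_const_right atTop 1 (tendsto_natCast_atTop_atTop (R := ℝ)))
  refine Summable.of_norm_bounded_eventually_nat h1 ?_
  filter_upwards [h2.eventually_lt_const one_pos] with j hj
  have hj0 : (0 : ℝ) < (j : ℝ) + 1 := by positivity
  have ha := h.nonneg j
  simp only [Function.comp] at hj
  rw [Real.norm_of_nonneg (by positivity), norm_mul, Complex.norm_real, Real.norm_of_nonneg ha,
    Complex.norm_natCast_cpow_of_pos (Nat.succ_pos j), ← Complex.ofReal_neg, Complex.ofReal_re]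
  push_cast
  rw [div_mul_eq_mul_div, mul_div_assoc]
  refine mul_le_mul_of_nonneg_left ?_ ha
  rw [neg_add, Real.rpow_add hj0, Real.rpow_neg hj0.le, Real.rpow_neg_one, div_eq_mul_inv]
  refine mul_le_mul_of_nonneg_right ?_ (by positivity)
  rw [← one_div, le_div_iff₀ (by positivity), mul_comm]
  refine (le_of_eq ?_).trans hj.le
  congr 2
  ring

lemma gammaKernel_term_eq (a : ℕ → ℝ) (α U : ℝ) (j : ℕ) :
    a j * ((j : ℝ) + 1) ^ (-α) * gammaKernel (α - 1) (Real.log (j + 1) - U) =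
      Real.exp (-((α - 1) * U)) *
        (a j / ((j : ℝ) + 1) * Real.exp (-((j + 1) * Real.exp (-U)))) := by
  have hj0 : (0 : ℝ) < (j : ℝ) + 1 := by positivity
  have h1 : ((j : ℝ) + 1) ^ (-α) * ((j : ℝ) + 1) ^ (α - 1) = ((j : ℝ) + 1)⁻¹ := by
    rw [← Real.rpow_add hj0, ← Real.rpow_neg_one]
    congr 1
    ring
  rw [gammaKernel_log_sub _ _ hj0, div_eq_mul_inv, ← h1]
  ring

/-- The Laplace transform of the coefficients, normalized by its order of growth. -/
noncomputable def laplaceProfile (a : ℕ → ℝ) (β U : ℝ) : ℝ :=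
  Real.exp (-(β * U)) * ∑' j : ℕ, a j / ((j : ℝ) + 1) * Real.exp (-((j + 1) * Real.exp (-U)))

lemma hasSum_laplaceProfile (h : HasPolarPart a α M κ Φ) (U : ℝ) :
    HasSum (fun j : ℕ => a j * ((j : ℝ) + 1) ^ (-α) * gammaKernel (α - 1) (Real.log (j + 1) - U))
      (laplaceProfile a (α - 1) U) := by
  simp only [gammaKernel_term_eq]
  exact (h.summable_laplace (Real.exp_pos _)).hasSum.mul_left _

lemma laplaceProfile_nonneg (h : HasPolarPart a α M κ Φ) (β U : ℝ) : 0 ≤ laplaceProfile a β U :=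
  mul_nonneg (Real.exp_pos _).le (tsum_nonneg fun j =>
    mul_nonneg (div_nonneg (h.nonneg j) (by positivity)) (Real.exp_pos _).le)

lemma exp_mul_laplaceProfile_le (h : HasPolarPart a α M κ Φ) (β U : ℝ) {s : ℝ} (hs : 0 ≤ s) :
    Real.exp (-(β * s)) * laplaceProfile a β U ≤ laplaceProfile a β (U + s) := by
  rw [laplaceProfile, laplaceProfile, ← mul_assoc, ← Real.exp_add,
    show -(β * s) + -(β * U) = -(β * (U + s)) by ring]
  refine mul_le_mul_of_nonneg_left ?_ (Real.exp_pos _).le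
  refine Summable.tsum_le_tsum (fun j => ?_) (h.summable_laplace (Real.exp_pos _))
    (h.summable_laplace (Real.exp_pos _))
  have ha := h.nonneg j
  gcongr
  linarith

lemma exists_laplaceProfile_le (h : HasPolarPart a α M κ Φ) (β : ℝ) :
    ∃ C, ∀ U ≤ 0, laplaceProfile a β U ≤ C := by
  have h1 := (tendsto_rpow_mul_exp_neg_mul_atTop_nhds_zero β (1 / 2) (by norm_num))
  obtain ⟨T, hT⟩ := eventually_atTop.mp (h1.eventually_le_const one_pos)
  have hcont : ContinuousOn (fun t : ℝ => t ^ β * Real.exp (-(1 / 2) * t)) (Set.Icc 1 T) :=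
    ContinuousOn.mul (fun t ht => (Real.continuousAt_rpow_const _ _ (Or.inl (by
      have := ht.1
      linarith))).continuousWithinAt) (by fun_prop)
  obtain ⟨B, hB⟩ := isCompact_Icc.bddAbove_image hcont
  have hbound : ∀ t : ℝ, 1 ≤ t → t ^ β * Real.exp (-(1 / 2) * t) ≤ max B 1 := by
    intro t ht
    rcases le_total t T with h2 | h2
    · exact (hB ⟨t, ⟨ht, h2⟩, rfl⟩).trans (le_max_left _ _)
    · exact (hT t h2).trans (le_max_right _ _)
  refine ⟨max B 1 * ∑' j : ℕ, a j / ((j : ℝ) + 1) * Real.exp (-((j + 1) * (1 / 2))),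
    fun U hU => ?_⟩
  have ht : 1 ≤ Real.exp (-U) := Real.one_le_exp (by linarith)
  rw [laplaceProfile, ← tsum_mul_left, ← tsum_mul_left]
  refine Summable.tsum_le_tsum (fun j => ?_) ((h.summable_laplace (Real.exp_pos _)).mul_left _)
    ((h.summable_laplace (by norm_num)).mul_left _)
  have ha : 0 ≤ a j / ((j : ℝ) + 1) := div_nonneg (h.nonneg j) (by positivity)
  rw [mul_left_comm, mul_left_comm (max B 1)]
  refine mul_le_mul_of_nonneg_left ?_ ha
  have h2 := hbound _ ht
  have h3 : Real.exp (-((j + 1) * Real.exp (-U))) ≤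
      Real.exp (-(1 / 2) * Real.exp (-U)) * Real.exp (-((j + 1) * (1 / 2))) := by
    rw [← Real.exp_add]
    refine Real.exp_le_exp.mpr ?_
    have hj : (0 : ℝ) ≤ j := Nat.cast_nonneg j
    nlinarith
  rw [← Real.exp_mul, show -U * β = -(β * U) by ring] at h2
  calc Real.exp (-(β * U)) * Real.exp (-((j + 1) * Real.exp (-U)))
      ≤ Real.exp (-(β * U)) *
        (Real.exp (-(1 / 2) * Real.exp (-U)) * Real.exp (-((j + 1) * (1 / 2)))) := by gcongr
    _ ≤ max B 1 * Real.exp (-((j + 1) * (1 / 2))) := by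
        rw [← mul_assoc]
        gcongr

variable {F : ℝ → ℝ} {ψ : ℝ → ℂ}

lemma smoothed_laplaceProfile (h : HasPolarPart a α M κ Φ) (hα : 1 < α)
    (hF : IsBandlimitedKernel M F ψ) (U : ℝ) :
    (Integrable fun w => F w * laplaceProfile a (α - 1) (U + w)) ∧
      ∫ w, F w * laplaceProfile a (α - 1) (U + w) = ∑' j : ℕ, a j * ((j : ℝ) + 1) ^ (-α) *
        ∫ w, F w * gammaKernel (α - 1) (Real.log (j + 1) - U - w) := by
  have hβ : 0 < α - 1 := by linarith
  have hk := integrable_gammaKernel hβ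
  have hG := hF.convolution (gammaKernel_nonneg (α - 1)) hk (integrable_pow_mul_gammaKernel hβ M)
  set f : ℕ → ℝ → ℝ := fun j w => a j * ((j : ℝ) + 1) ^ (-α) *
    (F w * gammaKernel (α - 1) (Real.log (j + 1) - U - w))
  have hcoef : ∀ j : ℕ, 0 ≤ a j * ((j : ℝ) + 1) ^ (-α) := fun j =>
    mul_nonneg (h.nonneg j) (by positivity)
  have hf : ∀ j w, 0 ≤ f j w := fun j w =>
    mul_nonneg (hcoef j) (mul_nonneg (hF.nonneg w) (gammaKernel_nonneg _ _))
  have hfi : ∀ j, Integrable (f j) := fun j =>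
    ((hk.comp_sub_left _).bdd_mul hF.continuous.aestronglyMeasurable
      (Eventually.of_forall hF.norm_le)).const_mul _
  have hfs : ∀ w, HasSum (fun j => f j w) (F w * laplaceProfile a (α - 1) (U + w)) := by
    intro w
    refine ((h.hasSum_laplaceProfile (U + w)).mul_left (F w)).congr_fun fun j => ?_
    simp only [f, sub_sub]
    ring
  have hInt : ∀ j, ∫ w, f j w = a j * ((j : ℝ) + 1) ^ (-α) *
      ∫ w, F w * gammaKernel (α - 1) (Real.log (j + 1) - U - w) := fun j => integral_const_mul _ _
  have hS : Summable fun j => ∫ w, f j w := by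
    simp only [hInt]
    exact hG.summable_boundary h U
  constructor
  · refine (integrable_tsum_of_nonneg hf hfi (fun w => (hfs w).summable) hS).congr
      (Eventually.of_forall fun w => (hfs w).tsum_eq)
  · have h1 := integral_tsum_of_summable_integral_norm hfi (by
      simpa only [Real.norm_of_nonneg (hf _ _)] using hS)
    simp only [hInt, (hfs _).tsum_eq] at h1
    exact h1.symm

lemma tendsto_laplaceProfile (h : HasPolarPart a α M κ Φ) (hα : 1 < α) {γ : ℝ} (hγ : κ M = γ) :
    Tendsto (fun U => laplaceProfile a (α - 1) U / U ^ M) atTop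
      (𝓝 (γ / M.factorial * Real.Gamma (α - 1))) := by
  have hβ : 0 < α - 1 := by linarith
  have hk := integrable_gammaKernel hβ
  obtain ⟨F, ψ, hF, hF1⟩ := exists_isBandlimitedKernel M
  have hcongr : ∀ l : ℝ, 0 < l → ∀ U v, F v * laplaceProfile a (α - 1) (U + v / l) =
      l⁻¹ * (fun w => l * F (l * w) * laplaceProfile a (α - 1) (U + w)) (v / l) := by
    intro l hl U v
    simp only
    rw [mul_div_cancel₀ v hl.ne']
    field_simp
  refine tendsto_div_pow_of_smoothed hβ.le (h.laplaceProfile_nonneg _)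
    (fun U s hs => h.exp_mul_laplaceProfile_le _ U hs) (h.exists_laplaceProfile_le _) hF.nonneg
    hF.integrable hF1 hF.moment (fun l hl U => ?_) (fun l hl => ?_)
  · simp only [hcongr l hl]
    exact ((h.smoothed_laplaceProfile hα (hF.scale hl) U).1.comp_div hl.ne').const_mul _
  · have hG := (hF.scale hl).convolution (gammaKernel_nonneg (α - 1)) hk
      (integrable_pow_mul_gammaKernel hβ M)
    have h1 := hG.tendsto_tsum_div h hγ
    have h2 : ∫ w, l * F (l * w) = 1 := by
      rw [integral_const_mul, Measure.integral_comp_mul_left, hF1, abs_of_pos (inv_pos.mpr hl),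
        smul_eq_mul, mul_one, mul_inv_cancel₀ hl.ne']
    rw [(hF.scale hl).integral_convolution hk, h2, one_mul, integral_gammaKernel hβ] at h1
    refine h1.congr fun U => ?_
    rw [← (h.smoothed_laplaceProfile hα (hF.scale hl) U).2]
    simp only [hcongr l hl]
    rw [integral_const_mul, Measure.integral_comp_div
      (fun w => l * F (l * w) * laplaceProfile a (α - 1) (U + w)), abs_of_pos hl, smul_eq_mul,
      inv_mul_cancel_left₀ hl.ne']

lemma tendsto_laplace_div (h : HasPolarPart a α M κ Φ) (hα : 1 < α) {γ : ℝ} (hγ : κ M = γ) :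
    Tendsto (fun t : ℝ => (∑' j : ℕ, a j / ((j : ℝ) + 1) * Real.exp (-((j + 1) * t))) /
      (t ^ (-(α - 1)) * Real.log (1 / t) ^ M)) (𝓝[>] 0)
      (𝓝 (γ / M.factorial * Real.Gamma (α - 1))) := by
  have h1 : Tendsto (fun t : ℝ => -Real.log t) (𝓝[>] 0) atTop :=
    tendsto_neg_atBot_atTop.comp Real.tendsto_log_nhdsGT_zero
  refine ((h.tendsto_laplaceProfile hα hγ).comp h1).congr' ?_
  filter_upwards [self_mem_nhdsWithin] with t ht
  have ht : 0 < t := ht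
  simp only [Function.comp, laplaceProfile, neg_neg, Real.exp_log ht]
  rw [one_div, Real.log_inv, Real.rpow_neg ht.le, Real.rpow_def_of_pos ht,
    show -((α - 1) * -Real.log t) = Real.log t * (α - 1) by ring]
  generalize ∑' j : ℕ, a j / ((j : ℝ) + 1) * Real.exp (-((j + 1) * t)) = A
  field_simp

end HasPolarPart

end LaplaceAsymptotics

section Assembly

open Filter Topology

lemma tendsto_log_normWeight_div (G : Type*) [Group G] [Group.FG G] {c : ℝ} (hc : 0 < c)
    (hgrowth : ∀ n : ℕ, 1 ≤ n → c * n ≤ (aCount G n : ℝ)) {α K : ℝ} (hα : 1 < α) (hK : 0 < K)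
    (M : ℕ) (hs : ∀ t : ℝ, 0 < t →
      Summable fun j : ℕ => (aCount G (j + 1) : ℝ) / (j + 1) * Real.exp (-((j + 1) * t)))
    (hA : Tendsto (fun t => (∑' j : ℕ, (aCount G (j + 1) : ℝ) / (j + 1) *
      Real.exp (-((j + 1) * t))) / (t ^ (-(α - 1)) * Real.log (1 / t) ^ M)) (𝓝[>] 0) (𝓝 K))
    {x : ℝ} (hx : 0 < x) :
    Tendsto (fun n : ℕ => Real.log (normWeight G x n) / (n * saddleScale α M n)) atTop
      (𝓝 (α / (α - 1) * (x * ((α - 1) * K) * (1 / α) ^ M) ^ (1 / α))) := by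
  have hβ : 0 < α - 1 := by linarith
  have hα0 : 0 < α := by linarith
  have hfin : ∀ j, Finite {L : Subgroup G // L.index = j + 1} := by
    intro j
    refine Nat.finite_of_card_ne_zero fun h => ?_
    have h1 := hgrowth (j + 1) (by omega)
    rw [aCount, h] at h1
    push_cast at h1
    have : 0 < c * (j + 1) := by positivity
    linarith
  set P := x * (K * (1 / α) ^ M) with hP
  set τ₀ := (x * ((α - 1) * K) * (1 / α) ^ M) ^ (1 / α) with hτ
  have hτ₀ : 0 < τ₀ := by positivity
  have hsaddle : (α - 1) * (P * τ₀ ^ (-(α - 1))) = τ₀ := by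
    have h1 : τ₀ ^ α = (α - 1) * P := by
      rw [hτ, ← Real.rpow_mul (by positivity), one_div_mul_cancel hα0.ne', Real.rpow_one, hP]
      ring
    rw [← mul_assoc, ← h1, ← Real.rpow_add hτ₀]
    simp
  have hV : τ₀ + P * τ₀ ^ (-(α - 1)) = α / (α - 1) * τ₀ := by
    have : P * τ₀ ^ (-(α - 1)) = τ₀ / (α - 1) := by
      rw [eq_div_iff hβ.ne', mul_comm]; exact hsaddle
    rw [this]
    field_simp
    ring
  rw [← hV]
  have hlarge : ∀ᶠ n : ℕ in atTop, (1 : ℝ) < n :=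
    tendsto_natCast_atTop_atTop.eventually (eventually_gt_atTop 1)
  refine tendsto_log_coeff_div (c := x * c) (β := α - 1) (u := fun n : ℕ => saddleScale α M n)
    (F := fun t => x * ∑' j : ℕ, (aCount G (j + 1) : ℝ) / (j + 1) * Real.exp (-((j + 1) * t)))
    (normWeight_pos hx) (mul_pos hx hc) ?_ ?_ ?_ (fun n => rfl) ?_ ?_ ?_ hβ hτ₀ hsaddle
  · intro n k hkn
    rw [normWeight_rec hfin x n, mul_assoc]
    refine mul_le_mul_of_nonneg_left ?_ hx.le
    have h1 := Finset.single_le_sum (f := fun j => (aCount G (j + 1) : ℝ) *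
      normWeight G x (n - (j + 1))) (fun j _ => mul_nonneg (Nat.cast_nonneg _)
      (normWeight_pos hx _).le) (Finset.mem_range.mpr (show n - k - 1 < n by omega))
    refine le_trans ?_ h1
    rw [show n - k - 1 + 1 = n - k by omega, Nat.sub_sub_self hkn.le]
    refine mul_le_mul_of_nonneg_right (le_trans ?_ (hgrowth (n - k) (by omega)))
      (normWeight_pos hx _).le
    refine le_mul_of_one_le_right hc.le ?_
    exact_mod_cast (show 1 ≤ n - k by omega)
  · intro t ht
    have hpow : ∀ j : ℕ, Real.exp (-t) ^ j = Real.exp (-(j * t)) := fun j => by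
      rw [← Real.exp_nat_mul]; ring_nf
    have h1 := hasSum_of_exp_rec (a := fun j => (aCount G (j + 1) : ℝ)) (h := normWeight G x)
      (x := x) (fun n => normWeight_rec hfin x n) (normWeight_zero x) (fun r hr0 hr1 => by
        have := hs (-Real.log r) (by have := Real.log_neg hr0 hr1; linarith)
        refine this.congr fun j => ?_
        rw [abs_of_nonneg (Nat.cast_nonneg _), mul_neg, neg_neg, ← Nat.cast_succ,
          Real.exp_nat_mul, Real.exp_log hr0])
      (Real.exp_pos (-t)) (by rw [Real.exp_lt_one_iff]; linarith)
    simp only [hpow] at h1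
    exact_mod_cast h1
  · filter_upwards [hlarge] with n hn
    exact saddleScale_pos α M hn
  · exact (tendsto_log_div_mul_saddleScale hα M).comp tendsto_natCast_atTop_atTop
  · exact (tendsto_mul_saddleScale hα M).comp tendsto_natCast_atTop_atTop
  · intro τ hτ
    have := ((tendsto_comp_saddleScale hα0 M hA hτ).comp
      tendsto_natCast_atTop_atTop).const_mul x
    rw [show P * τ ^ (-(α - 1)) = x * (K * (1 / α) ^ M * τ ^ (-(α - 1))) by rw [hP]; ring]
    refine this.congr fun n => ?_
    simp only [Function.comp]
    ring

lemma tendsto_expVal_div (G : Type*) [Group G] [Group.FG G] {c : ℝ} (hc : 0 < c)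
    (hgrowth : ∀ n : ℕ, 1 ≤ n → c * n ≤ (aCount G n : ℝ)) {α K : ℝ} (hα : 1 < α) (hK : 0 < K)
    (M : ℕ) (hs : ∀ t : ℝ, 0 < t →
      Summable fun j : ℕ => (aCount G (j + 1) : ℝ) / (j + 1) * Real.exp (-((j + 1) * t)))
    (hA : Tendsto (fun t => (∑' j : ℕ, (aCount G (j + 1) : ℝ) / (j + 1) *
      Real.exp (-((j + 1) * t))) / (t ^ (-(α - 1)) * Real.log (1 / t) ^ M)) (𝓝[>] 0) (𝓝 K))
    {x : ℝ} (hx : 0 < x) :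
    Tendsto (fun n : ℕ => expVal G n x id / (n * saddleScale α M n)) atTop
      (𝓝 (1 / (α - 1) * (x * ((α - 1) * K) * (1 / α) ^ M) ^ (1 / α))) := by
  have hβ : 0 < α - 1 := by linarith
  have hα0 : 0 < α := by linarith
  set V := (x * ((α - 1) * K) * (1 / α) ^ M) ^ (1 / α) with hV
  refine tendsto_div_of_subgradient
    (ℓ := fun n ε => Real.log (normWeight G (x * Real.exp ε) n))
    (L := fun ε => α / (α - 1) * V * Real.exp (ε * (1 / α))) ?_ ?_ ?_ ?_
  · intro n ε
    have h1 := Real.log_le_log (by have := normWeight_pos (G := G) hx n; positivity)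
      (exp_mul_expVal_le (G := G) hx n ε)
    rw [Real.log_mul (by positivity) (normWeight_pos hx n).ne', Real.log_exp] at h1
    simpa using h1
  · exact ((tendsto_mul_saddleScale hα M).comp
      tendsto_natCast_atTop_atTop).eventually_gt_atTop 0
  · intro ε
    have hxε : 0 < x * Real.exp ε := by positivity
    have := tendsto_log_normWeight_div G hc hgrowth hα hK M hs hA hxε
    convert this using 2
    rw [show x * Real.exp ε * ((α - 1) * K) * (1 / α) ^ M =
      (x * ((α - 1) * K) * (1 / α) ^ M) * Real.exp ε by ring, Real.mul_rpow (by positivity)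
      (by positivity), ← Real.exp_mul, ← hV, mul_assoc]
  · have h1 : HasDerivAt (fun ε : ℝ => Real.exp (ε * (1 / α))) (1 / α) 0 := by
      have := ((hasDerivAt_id (0 : ℝ)).mul_const (1 / α)).exp
      simpa using this
    rw [show 1 / (α - 1) * V = α / (α - 1) * V * (1 / α) by field_simp]
    exact h1.const_mul _

end Assembly

lemma hasPolarPart_aCount (G : Type*) [Group G] {α γ : ℝ} {m : ℕ} (hm : 1 ≤ m) {ν : ℕ → ℂ}
    {Φ : ℂ → ℂ} (hΦc : ContinuousOn Φ {s : ℂ | α ≤ s.re})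
    (hsum : ∀ s : ℂ, α < s.re →
      Summable fun δ : ℕ => ‖(aCount G (δ + 1) : ℂ) * ((δ + 1 : ℕ) : ℂ) ^ (-s)‖)
    (hval : ∀ s : ℂ, α < s.re →
      ∑' δ : ℕ, (aCount G (δ + 1) : ℂ) * ((δ + 1 : ℕ) : ℂ) ^ (-s) =
        (γ : ℂ) / (s - (α : ℂ)) ^ m
          + (∑ j ∈ Finset.Icc 1 (m - 1), ν j / (s - (α : ℂ)) ^ j) + Φ s) :
    HasPolarPart (fun j => (aCount G (j + 1) : ℝ)) α (m - 1)
      (fun j => if j = m - 1 then (γ : ℂ) else ν (j + 1)) Φ where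
  nonneg j := Nat.cast_nonneg _
  continuousOn := hΦc
  summable s hs := by simpa only [Complex.ofReal_natCast] using hsum s hs
  eq s hs := by
    simp only [Complex.ofReal_natCast]
    rw [hval s hs, Finset.sum_range_succ, if_pos rfl, Nat.sub_add_cancel hm, add_comm (γ / _ : ℂ)]
    congr 2
    rw [← Finset.Ico_add_one_right_eq_Icc, Finset.sum_Ico_eq_sum_range, Nat.add_sub_cancel]
    refine Finset.sum_congr rfl fun j hj => ?_
    rw [if_neg (Finset.mem_range.mp hj).ne, add_comm 1]

theorem mean_asymptotics
    (G : Type*) [Group G] [Group.FG G]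
    (c : ℝ) (hc : 0 < c) (hgrowth : ∀ n : ℕ, 1 ≤ n → c * n ≤ (aCount G n : ℝ))
    (α : ℝ) (hα : 2 ≤ α) (m : ℕ) (hm : 1 ≤ m) (γ : ℝ) (hγ : 0 < γ)
    (ν : ℕ → ℂ) (Φ : ℂ → ℂ)
    (hΦc : ContinuousOn Φ {s : ℂ | α ≤ s.re})
    (hΦd : DifferentiableOn ℂ Φ {s : ℂ | α < s.re})
    (hsum : ∀ s : ℂ, α < s.re →
      Summable fun δ : ℕ => ‖(aCount G (δ + 1) : ℂ) * ((δ + 1 : ℕ) : ℂ) ^ (-s)‖)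
    (hval : ∀ s : ℂ, α < s.re →
      ∑' δ : ℕ, (aCount G (δ + 1) : ℂ) * ((δ + 1 : ℕ) : ℂ) ^ (-s) =
        (γ : ℂ) / (s - (α : ℂ)) ^ m
          + (∑ j ∈ Finset.Icc 1 (m - 1), ν j / (s - (α : ℂ)) ^ j) + Φ s)
    (x : ℝ) (hx : 0 < x) :
    Asymptotics.IsEquivalent Filter.atTop
      (fun n : ℕ => expVal G n x id)
      (fun n : ℕ =>
        (1 / (α - 1)) * α ^ (-(((m : ℝ) - 1) / α)) *
          (x * (Real.Gamma α * γ / (Nat.factorial (m - 1) : ℝ))) ^ (1 / α) *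
          (n : ℝ) ^ ((α - 1) / α) * Real.log n ^ (((m : ℝ) - 1) / α)) := by
  have hα0 : 0 < α := by linarith
  have hα1 : 0 < α - 1 := by linarith
  have hD := hasPolarPart_aCount G hm hΦc hsum hval
  have hfact : (0 : ℝ) < (m - 1).factorial := by positivity
  have hΓ := Real.Gamma_pos_of_pos hα0
  have hΓ1 := Real.Gamma_pos_of_pos hα1
  have hΓα : Real.Gamma α = (α - 1) * Real.Gamma (α - 1) := by
    rw [← Real.Gamma_add_one hα1.ne', sub_add_cancel]
  have hM : ((m - 1 : ℕ) : ℝ) = (m : ℝ) - 1 := by rw [Nat.cast_sub hm, Nat.cast_one]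
  have hlim := tendsto_expVal_div G hc hgrowth (by linarith) (by positivity) (m - 1)
    (fun t ht => hD.summable_laplace ht)
    (hD.tendsto_laplace_div (by linarith) (if_pos rfl)) hx
  set B := (1 / (α - 1)) * α ^ (-(((m : ℝ) - 1) / α)) *
    (x * (Real.Gamma α * γ / (Nat.factorial (m - 1) : ℝ))) ^ (1 / α)
  have hB : 0 < B := by positivity
  have hconst : 1 / (α - 1) * (x * ((α - 1) * (γ / (m - 1).factorial * Real.Gamma (α - 1))) *
      (1 / α) ^ (m - 1)) ^ (1 / α) = B := by
    have hpow : ((1 / α) ^ (m - 1)) ^ (1 / α) = α ^ (-(((m : ℝ) - 1) / α)) := by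
      rw [← Real.rpow_natCast, ← Real.rpow_mul (by positivity), hM, mul_one_div, one_div,
        Real.inv_rpow hα0.le, ← Real.rpow_neg hα0.le]
    have hcoeff : (α - 1) * (γ / (m - 1).factorial * Real.Gamma (α - 1)) =
        Real.Gamma α * γ / (m - 1).factorial := by
      rw [hΓα]
      ring
    rw [Real.mul_rpow (by positivity) (by positivity), hpow, hcoeff]
    ring
  rw [hconst] at hlim
  refine Asymptotics.isEquivalent_of_tendsto_one ?_
  have h1 := hlim.div_const B
  rw [div_self hB.ne'] at h1
  refine h1.congr' ?_
  filter_upwards [Filter.eventually_gt_atTop 0] with n hn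
  have hn : (0 : ℝ) < n := by exact_mod_cast hn
  rw [mul_saddleScale _ hn, hM, div_div, Pi.div_apply, show 1 - 1 / α = (α - 1) / α by field_simp]
  congr 1
  ring
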